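/- arXiv:1305.2516 — 2 statements merged into one kernel-verified Lean document; each statement's English description precedes it below -/
import Mathlib

section
/- Sparse regularity lemma (Kohayakawa–Rödl): For every ε > 0, every D > 0, and every positive integer t₀, there exist η > 0 and a positive integer T such that for every p ∈ [0,1], every graph G with at least t₀ vertices that is (η,p,D)-upper-uniform admits an (ε,p)-regular partition V₁, …, V_t of its vertex set into t pieces with t₀ ≤ t ≤ T. -/
open Finset Filter
open scoped Classical

/-- Number of ordered pairs `(x, y) ∈ X × Y` with `x` adjacent to `y` in `G`. -/
noncomputable def edgesBetween {V : Type} (G : SimpleGraph V) (X Y : Finset V) : ℕ :=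
  ((X ×ˢ Y).filter fun pq => G.Adj pq.1 pq.2).card

/-- Edge density between `X` and `Y`. -/
noncomputable def density {V : Type} (G : SimpleGraph V) (X Y : Finset V) : ℝ :=
  (edgesBetween G X Y : ℝ) / ((X.card : ℝ) * (Y.card : ℝ))

/-- The pair `(A, B)` is `(ε, p)`-regular in `G`. -/
def IsRegularPair {V : Type} (G : SimpleGraph V) (A B : Finset V) (ε p : ℝ) : Prop :=
  ∀ A' ⊆ A, ∀ B' ⊆ B, ε * A.card ≤ A'.card → ε * B.card ≤ B'.card →
    |density G A' B' - density G A B| ≤ ε * p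

/-- The pair `(A, B)` is `(ε, d)`-lower-regular in `G`. -/
def IsLowerRegularPair {V : Type} (G : SimpleGraph V) (A B : Finset V) (ε d : ℝ) : Prop :=
  ∀ A' ⊆ A, ∀ B' ⊆ B, ε * A.card ≤ A'.card → ε * B.card ≤ B'.card →
    d ≤ density G A' B'

/-- Number of edges of `H` with both endpoints in `S`. -/
noncomputable def edgesWithin {V : Type} (H : SimpleGraph V) (S : Finset V) : ℕ :=
  {e ∈ H.edgeSet | ∀ v ∈ e, v ∈ S}.ncard

/-- Number of edges of `H`. -/
noncomputable def edgeCount {V : Type} (H : SimpleGraph V) : ℕ := H.edgeSet.ncard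

/-- The 2-density `m₂(H)`. -/
noncomputable def twoDensity {k : ℕ} (H : SimpleGraph (Fin k)) : ℝ :=
  max (1/2) (sSup {x : ℝ | ∃ S : Finset (Fin k), 3 ≤ S.card ∧
    x = ((edgesWithin H S : ℝ) - 1) / ((S.card : ℝ) - 2)})

/-- `H` is strictly balanced: every proper subgraph has strictly smaller 2-density. -/
def StrictlyBalanced {k : ℕ} (H : SimpleGraph (Fin k)) : Prop :=
  ∀ H' : SimpleGraph (Fin k), H' ≤ H → H' ≠ H → twoDensity H' < twoDensity H

/-- `G` contains a copy of `H`. -/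
def ContainsCopy {V W : Type} (H : SimpleGraph V) (G : SimpleGraph W) : Prop :=
  ∃ f : V → W, Function.Injective f ∧ ∀ a b, H.Adj a b → G.Adj (f a) (f b)

/-- Number of canonical copies of `H` in `G` w.r.t. the parts `P`. -/
noncomputable def canonicalCount {k : ℕ} {W : Type} (H : SimpleGraph (Fin k))
    (G : SimpleGraph W) (P : Fin k → Finset W) : ℕ :=
  {f : Fin k → W | (∀ i, f i ∈ P i) ∧ ∀ i j, H.Adj i j → G.Adj (f i) (f j)}.ncard

/-- Probability that `G_{n,p}` satisfies the predicate `P`. -/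
noncomputable def gnpProb (n : ℕ) (p : ℝ) (P : SimpleGraph (Fin n) → Prop) : ℝ :=
  ∑ G ∈ Finset.univ.filter P, p ^ edgeCount G * (1 - p) ^ (n.choose 2 - edgeCount G)

/-- Probability that the `p`-random subgraph `G_p` of `G` satisfies the predicate `P`. -/
noncomputable def subgraphProb {V : Type} [Fintype V] [DecidableEq V] (G : SimpleGraph V)
    (p : ℝ) (P : SimpleGraph V → Prop) : ℝ :=
  ∑ G' ∈ Finset.univ.filter (fun G' => G' ≤ G ∧ P G'),
    p ^ edgeCount G' * (1 - p) ^ (edgeCount G - edgeCount G')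

/-- The chromatic number of `H`, as a natural number. -/
noncomputable def chrom {k : ℕ} (H : SimpleGraph (Fin k)) : ℕ := H.chromaticNumber.toNat

/-- The edges of `H`, each represented once as an ordered pair `(i, j)` with `i < j`. -/
noncomputable def hPairs {k : ℕ} (H : SimpleGraph (Fin k)) : Finset (Fin k × Fin k) :=
  Finset.univ.filter fun ij => H.Adj ij.1 ij.2 ∧ ij.1 < ij.2

/-- Membership in `𝒢(H, n, m, p, ε)` (with parts `P`, inside ambient vertex type). -/
def InG {k N : ℕ} (H : SimpleGraph (Fin k)) (G : SimpleGraph (Fin N))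
    (P : Fin k → Finset (Fin N)) (n m : ℕ) (p ε : ℝ) : Prop :=
  (∀ i j, i ≠ j → Disjoint (P i) (P j)) ∧
  (∀ i, (P i).card = n) ∧
  (∀ u v, G.Adj u v → ∃ i j, H.Adj i j ∧ u ∈ P i ∧ v ∈ P j) ∧
  (∀ i j, H.Adj i j → IsRegularPair G (P i) (P j) ε p) ∧
  (∀ i j, H.Adj i j → edgesBetween G (P i) (P j) = m)

/-- Membership in `𝒢_ℓ(H, n, d, ε)` (lower-regular pairs, parts `P` covering the vertex set). -/
def InGl {k : ℕ} {W : Type} (H : SimpleGraph (Fin k)) (G : SimpleGraph W)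
    (P : Fin k → Finset W) (n : ℕ) (d ε : ℝ) : Prop :=
  (∀ i j, i ≠ j → Disjoint (P i) (P j)) ∧
  (∀ i, (P i).card = n) ∧
  (∀ v, ∃ i, v ∈ P i) ∧
  (∀ u v, G.Adj u v → ∃ i j, H.Adj i j ∧ u ∈ P i ∧ v ∈ P j) ∧
  (∀ i j, H.Adj i j → IsLowerRegularPair G (P i) (P j) ε d)

/-- `|𝒞(H,G;H',G')|`: canonical copies of `H` in `G` whose `H'`-edges lie in `G'`. -/
noncomputable def restrictedCount {k : ℕ} {W : Type} (H : SimpleGraph (Fin k))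
    (G : SimpleGraph W) (H' : SimpleGraph (Fin k)) (G' : SimpleGraph W)
    (P : Fin k → Finset W) : ℕ :=
  {f : Fin k → W | (∀ i, f i ∈ P i) ∧ (∀ i j, H.Adj i j → G.Adj (f i) (f j)) ∧
    (∀ i j, H'.Adj i j → G'.Adj (f i) (f j))}.ncard

/-- Number of copies of `H` in `G`, i.e. subgraphs of `G` isomorphic to `H`. -/
noncomputable def copyCount {k : ℕ} {W : Type} (H : SimpleGraph (Fin k))
    (G : SimpleGraph W) : ℕ :=
  {G' : G.Subgraph | Nonempty (G'.coe ≃g H)}.ncard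

/-- Number of `k`-cliques of `G`. -/
noncomputable def cliqueCount {V : Type} (k : ℕ) (G : SimpleGraph V) : ℕ :=
  {s : Finset V | G.IsNClique k s}.ncard

/-- `g_k(ρ, n)`: minimum number of `K_k`s in an `n`-vertex graph with at least `ρ·C(n,2)` edges. -/
noncomputable def gkn (k n : ℕ) (ρ : ℝ) : ℕ :=
  sInf {m : ℕ | ∃ G : SimpleGraph (Fin n),
    ρ * (n.choose 2 : ℝ) ≤ (edgeCount G : ℝ) ∧ cliqueCount k G = m}

/-- The clique density function `g_k(ρ) = lim_{n → ∞} g_k(ρ, n)/C(n,k)`. -/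
noncomputable def gk (k : ℕ) (ρ : ℝ) : ℝ :=
  limUnder atTop (fun n => (gkn k n ρ : ℝ) / (n.choose k : ℝ))

/-- `G` is `(η, p, D)`-upper-uniform. -/
def UpperUniform {V : Type} [Fintype V] (G : SimpleGraph V) (η p D : ℝ) : Prop :=
  ∀ U₁ U₂ : Finset V, Disjoint U₁ U₂ →
    η * (Fintype.card V : ℝ) ≤ U₁.card → η * (Fintype.card V : ℝ) ≤ U₂.card →
    density G U₁ U₂ ≤ D * p

/-- `G` is `(η, p, D)`-upper-uniform, also for edges inside a single set. -/
def UpperUniform' {V : Type} [Fintype V] (G : SimpleGraph V) (η p D : ℝ) : Prop :=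
  UpperUniform G η p D ∧
  ∀ U : Finset V, η * (Fintype.card V : ℝ) ≤ U.card →
    (edgesWithin G U : ℝ) ≤ D * p * (U.card.choose 2 : ℝ)

/-- `H` is a star forest. -/
def IsStarForest {V : Type} (H : SimpleGraph V) : Prop :=
  ∃ c : V → V, ∀ u v, H.Adj u v → c u = c v ∧ (c u = u ∨ c u = v)

/-- `G` is `(H, r)`-Ramsey. -/
def IsRamsey {k n : ℕ} (H : SimpleGraph (Fin k)) (r : ℕ) (G : SimpleGraph (Fin n)) : Prop :=
  ∀ col : Sym2 (Fin n) → Fin r, ∃ c : Fin r, ∃ f : Fin k → Fin n, Function.Injective f ∧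
    ∀ a b, H.Adj a b → G.Adj (f a) (f b) ∧ col s(f a, f b) = c

/-- `G` is `(H, ε)`-Turán. -/
def IsTuran {k n : ℕ} (H : SimpleGraph (Fin k)) (ε : ℝ) (G : SimpleGraph (Fin n)) : Prop :=
  ∀ G' : SimpleGraph (Fin n), G' ≤ G →
    (1 - 1 / ((chrom H : ℝ) - 1) + ε) * (edgeCount G : ℝ) ≤ (edgeCount G' : ℝ) →
    ContainsCopy H G'

/-- The normalized homomorphism count `μ_H(G)`. -/
noncomputable def muH {k N : ℕ} (H : SimpleGraph (Fin k)) (G : SimpleGraph (Fin N)) : ℝ :=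
  (∑ f : Fin k → Fin N, ∏ ij ∈ hPairs H, (if G.Adj (f ij.1) (f ij.2) then (1:ℝ) else 0))
    / (N : ℝ) ^ k

/-- Membership in `H*(V₁, …, V_k)`: all edges lie between pairs `Vᵢ, Vⱼ` with `ij ∈ E(H)`. -/
def InHstar {k N : ℕ} (H : SimpleGraph (Fin k)) (G : SimpleGraph (Fin N))
    (P : Fin k → Finset (Fin N)) : Prop :=
  ∀ u v, G.Adj u v → ∃ i j, H.Adj i j ∧ u ∈ P i ∧ v ∈ P j

/-- The normalized canonical homomorphism count `μ*_H(G)`. -/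
noncomputable def muHstar {k N : ℕ} (H : SimpleGraph (Fin k)) (G : SimpleGraph (Fin N))
    (P : Fin k → Finset (Fin N)) : ℝ :=
  (∑ f ∈ Finset.univ.filter (fun f : Fin k → Fin N => ∀ i, f i ∈ P i),
    ∏ ij ∈ hPairs H, (if G.Adj (f ij.1) (f ij.2) then (1:ℝ) else 0)) / (N : ℝ) ^ k

/-- The indicator function of adjacency. -/
noncomputable def adjInd {V : Type} (G : SimpleGraph V) (z : V × V) : ℝ :=
  if G.Adj z.1 z.2 then 1 else 0

lemma adjInd_nonneg {V : Type} (G : SimpleGraph V) (z : V × V) : 0 ≤ adjInd G z := by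
  unfold adjInd; split_ifs <;> norm_num

lemma edgesBetween_eq {V : Type} (G : SimpleGraph V) (X Y : Finset V) :
    (edgesBetween G X Y : ℝ) = ∑ z ∈ X ×ˢ Y, adjInd G z := by
  unfold edgesBetween adjInd
  rw [Finset.sum_boole]

lemma density_mul {V : Type} (G : SimpleGraph V) (X Y : Finset V) :
    ∑ z ∈ X ×ˢ Y, adjInd G z = density G X Y * ((X ×ˢ Y).card : ℝ) := by
  rw [← edgesBetween_eq, density, Finset.card_product]
  push_cast
  by_cases h : ((X.card : ℝ) * (Y.card : ℝ)) = 0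
  · rw [h]
    have h' : (X ×ˢ Y).card = 0 := by
      rw [Finset.card_product]; exact_mod_cast h
    rw [edgesBetween_eq, Finset.card_eq_zero.mp h']
    simp
  · rw [div_mul_cancel₀ _ h]

lemma density_nonneg {V : Type} (G : SimpleGraph V) (X Y : Finset V) : 0 ≤ density G X Y := by
  unfold density; positivity

/-- Change of the quadratic functional on one block. -/
lemma block_gain {β : Type} (W R : Finset β) (hR : R ⊆ W) (f : β → ℝ) (d d' γ : ℝ)
    (hd : ∑ z ∈ W, f z = d * W.card) (hd' : ∑ z ∈ R, f z = d' * R.card) :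
    ∑ z ∈ W, (2 * γ * f z - γ ^ 2) + R.card * (d' - d) ^ 2 ≤
      ∑ z ∈ W, (2 * (if z ∈ R then d' else d) * f z - (if z ∈ R then d' else d) ^ 2) := by
  have h1 : ∀ z ∈ W, (2 * (if z ∈ R then d' else d) * f z - (if z ∈ R then d' else d) ^ 2)
      = (2 * d * f z - d ^ 2) +
        (if z ∈ R then (2 * (d' - d) * f z - (d' ^ 2 - d ^ 2)) else 0) := by
    intro z _; split_ifs <;> ring
  rw [Finset.sum_congr rfl h1, Finset.sum_add_distrib, ← Finset.sum_filter,
    Finset.filter_mem_eq_inter, Finset.inter_eq_right.mpr hR]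
  simp only [Finset.sum_sub_distrib, ← Finset.mul_sum, Finset.sum_const, nsmul_eq_mul, hd, hd']
  nlinarith [mul_nonneg (Nat.cast_nonneg (α := ℝ) W.card) (sq_nonneg (d - γ))]

lemma perm_pair {V : Type} [Fintype V] (a b a' b' : V) (h : a ≠ b) (h' : a' ≠ b') :
    ∃ τ : Equiv.Perm V, τ a = a' ∧ τ b = b' := by
  refine ⟨(Equiv.swap a a').trans (Equiv.swap (Equiv.swap a a' b) b'), ?_, ?_⟩
  · simp only [Equiv.trans_apply, Equiv.swap_apply_left]
    apply Equiv.swap_apply_of_ne_of_ne _ h'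
    intro hh
    apply h
    apply (Equiv.swap a a').injective
    rw [← hh, Equiv.swap_apply_left]
  · simp

/-- Upper uniformity bounds the total number of edges. -/
lemma total_edges {V : Type} [Fintype V] (G : SimpleGraph V) (η p D : ℝ) (hη : η ≤ 1 / 4)
    (hn : 2 ≤ Fintype.card V) (hU : UpperUniform G η p D) :
    ∑ z : V × V, adjInd G z ≤ D * p * (Fintype.card V : ℝ) ^ 2 := by
  set n := Fintype.card V with hnn
  set m := n / 2 with hm
  have hm1 : 1 ≤ m := by omega
  obtain ⟨A, -, hA⟩ := Finset.exists_subset_card_eq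
    (s := (Finset.univ : Finset V)) (n := m) (by rw [Finset.card_univ]; omega)
  obtain ⟨B, hBs, hB⟩ := Finset.exists_subset_card_eq
    (s := (Finset.univ \ A : Finset V)) (n := m)
    (by rw [Finset.card_sdiff_of_subset (Finset.subset_univ _), Finset.card_univ]; omega)
  have hAB : Disjoint A B := by
    rw [Finset.disjoint_right]
    intro x hx hx'
    exact (Finset.mem_sdiff.mp (hBs hx)).2 hx'
  have hmr : η * (n : ℝ) ≤ m := by
    have h4 : n ≤ 4 * m := by omega
    have h4' : (n : ℝ) ≤ 4 * m := by exact_mod_cast h4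
    have : (0 : ℝ) ≤ n := Nat.cast_nonneg _
    nlinarith
  -- the bound for each permutation
  have hσ : ∀ σ : Equiv.Perm V,
      ∑ z ∈ A ×ˢ B, adjInd G (σ z.1, σ z.2) ≤ D * p * (m : ℝ) ^ 2 := by
    intro σ
    have h1 := hU (A.map σ.toEmbedding) (B.map σ.toEmbedding)
      (by rwa [Finset.disjoint_map]) (by rw [Finset.card_map, hA]; exact hmr)
      (by rw [Finset.card_map, hB]; exact hmr)
    have h2 := density_mul G (A.map σ.toEmbedding) (B.map σ.toEmbedding)
    rw [Finset.card_product, Finset.card_map, Finset.card_map, hA, hB] at h2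
    have h3 : ∑ z ∈ A ×ˢ B, adjInd G (σ z.1, σ z.2)
        = ∑ z ∈ (A.map σ.toEmbedding) ×ˢ (B.map σ.toEmbedding), adjInd G z := by
      rw [Finset.sum_product, Finset.sum_product, Finset.sum_map]
      simp
    rw [h3, h2]
    push_cast
    nlinarith [mul_nonneg (Nat.cast_nonneg (α := ℝ) m) (Nat.cast_nonneg (α := ℝ) m)]
  set c : V × V → ℝ := fun z => ∑ σ : Equiv.Perm V, adjInd G (σ z.1, σ z.2) with hc
  obtain ⟨a0, ha0⟩ : A.Nonempty := Finset.card_pos.mp (by omega)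
  obtain ⟨b0, hb0⟩ : B.Nonempty := Finset.card_pos.mp (by omega)
  have hne : ∀ a ∈ A, ∀ b ∈ B, a ≠ b := by
    intro a ha b hb h
    subst h
    exact Finset.disjoint_left.mp hAB ha hb
  have hconst : ∀ z : V × V, z.1 ≠ z.2 → c z = c (a0, b0) := by
    intro z hz
    obtain ⟨τ, h1, h2⟩ := perm_pair a0 b0 z.1 z.2 (hne _ ha0 _ hb0) hz
    simp only [hc]
    rw [← Equiv.sum_comp (Equiv.mulRight τ) (fun σ : Equiv.Perm V => adjInd G (σ a0, σ b0))]
    simp [h1, h2]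
  have hc0 : 0 ≤ c (a0, b0) := Finset.sum_nonneg fun _ _ => adjInd_nonneg _ _
  have hle : ∀ z : V × V, c z ≤ c (a0, b0) := by
    intro z
    by_cases hz : z.1 = z.2
    · have : c z = 0 := by
        simp only [hc, adjInd, hz]
        simp
      rw [this]; exact hc0
    · exact (hconst z hz).le
  -- first count
  have hfirst : (m : ℝ) ^ 2 * c (a0, b0) ≤
      (Fintype.card (Equiv.Perm V) : ℝ) * (D * p * (m : ℝ) ^ 2) := by
    have h1 : ∑ z ∈ A ×ˢ B, c z = (m : ℝ) ^ 2 * c (a0, b0) := by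
      rw [Finset.sum_congr rfl (g := fun _ => c (a0, b0))]
      · rw [Finset.sum_const, Finset.card_product, hA, hB]
        push_cast [nsmul_eq_mul]
        ring
      · intro z hz
        rw [Finset.mem_product] at hz
        exact hconst z (hne _ hz.1 _ hz.2)
    rw [← h1]
    simp only [hc]
    rw [Finset.sum_comm]
    calc _ ≤ ∑ σ : Equiv.Perm V, D * p * (m : ℝ) ^ 2 := Finset.sum_le_sum fun σ _ => hσ σ
      _ = _ := by rw [Finset.sum_const, Finset.card_univ, nsmul_eq_mul]
  have hsecond : (Fintype.card (Equiv.Perm V) : ℝ) * ∑ z : V × V, adjInd G z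
      ≤ (n : ℝ) ^ 2 * c (a0, b0) := by
    have h1 : ∑ z : V × V, c z =
        (Fintype.card (Equiv.Perm V) : ℝ) * ∑ z : V × V, adjInd G z := by
      simp only [hc]
      rw [Finset.sum_comm]
      rw [Finset.sum_congr rfl (g := fun _ => ∑ z : V × V, adjInd G z)]
      · rw [Finset.sum_const, Finset.card_univ, nsmul_eq_mul]
      · intro σ _
        exact Equiv.sum_comp (Equiv.prodCongr σ σ) (adjInd G)
    rw [← h1]
    calc _ ≤ ∑ z : V × V, c (a0, b0) := Finset.sum_le_sum fun z _ => hle z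
      _ = _ := by
        rw [Finset.sum_const, Finset.card_univ, Fintype.card_prod, nsmul_eq_mul]
        push_cast
        ring
  have hmpos : (0 : ℝ) < (m : ℝ) ^ 2 := by
    have : (0 : ℝ) < m := by exact_mod_cast hm1
    positivity
  have hN : (0 : ℝ) < (Fintype.card (Equiv.Perm V) : ℝ) := by
    exact_mod_cast Fintype.card_pos
  have hc1 : c (a0, b0) ≤ (Fintype.card (Equiv.Perm V) : ℝ) * (D * p) := by
    by_contra hcon
    push Not at hcon
    nlinarith
  by_contra hcon
  push Not at hcon
  have h5 : (n : ℝ) ^ 2 * c (a0, b0) ≤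
      (n : ℝ) ^ 2 * ((Fintype.card (Equiv.Perm V) : ℝ) * (D * p)) :=
    mul_le_mul_of_nonneg_left hc1 (sq_nonneg _)
  nlinarith

/-- Interval equipartition of `Fin n` into `t` pieces. -/
lemma interval_card (n t : ℕ) (ht : 0 < t) (htn : t ≤ n) (i : Fin t) (q : Fin n → Fin t)
    (hq : ∀ r, (q r : ℕ) = r * t / n) :
    n / t ≤ (Finset.univ.filter fun r => q r = i).card ∧
    (Finset.univ.filter fun r => q r = i).card ≤ n / t + 1 := by
  have hn : 0 < n := lt_of_lt_of_le ht htn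
  set A := (i * n + (t - 1)) / t with hA
  set B := ((i + 1) * n + (t - 1)) / t with hB
  have hA1 : A * t ≤ i * n + (t - 1) := Nat.div_mul_le_self _ _
  have hA2 : i * n + (t - 1) < (A + 1) * t := by
    have := Nat.lt_div_mul_add (a := i * n + (t - 1)) ht
    rw [add_mul, one_mul]; exact this
  have hB1 : B * t ≤ (i + 1) * n + (t - 1) := Nat.div_mul_le_self _ _
  have hB2 : (i + 1) * n + (t - 1) < (B + 1) * t := by
    have := Nat.lt_div_mul_add (a := (i + 1) * n + (t - 1)) ht
    rw [add_mul B, one_mul]; exact this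
  have hBn : B ≤ n := by
    have hi : (i : ℕ) + 1 ≤ t := i.2
    by_contra hcon
    push Not at hcon
    have h1 : (n + 1) * t ≤ B * t := Nat.mul_le_mul_right _ hcon
    have h2 : ((i : ℕ) + 1) * n ≤ t * n := Nat.mul_le_mul_right _ hi
    have h3 : (n + 1) * t = t * n + t := by ring
    omega
  have hcard : (Finset.univ.filter fun r => q r = i).card = B - A := by
    rw [← Nat.card_Ico]
    rw [← Finset.card_map Fin.valEmbedding]
    congr 1
    ext r
    simp only [Finset.mem_map, Finset.mem_filter, Finset.mem_univ, true_and,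
      Fin.valEmbedding_apply, Finset.mem_Ico]
    have key : ∀ r : ℕ, r * t / n = i ↔ A ≤ r ∧ r < B := by
      intro r
      rw [Nat.div_eq_iff hn]
      constructor
      · rintro ⟨h1, h2⟩
        constructor
        · by_contra hcon
          have : (r + 1) * t ≤ A * t := Nat.mul_le_mul_right _ (by omega)
          rw [add_mul] at this
          omega
        · by_contra hcon
          have : (B + 1) * t ≤ (r + 1) * t := Nat.mul_le_mul_right _ (by omega)
          rw [add_mul r] at this
          have h3 : ((i : ℕ) + 1) * n = i * n + n := by ring
          omega
      · rintro ⟨h1, h2⟩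
        have h3 : ((i : ℕ) + 1) * n = i * n + n := by ring
        have h4 : (A + 1) * t ≤ (r + 1) * t := Nat.mul_le_mul_right _ (by omega)
        have h5 : (r + 1) * t ≤ B * t := Nat.mul_le_mul_right _ (by omega)
        rw [add_mul r] at h4 h5
        omega
    constructor
    · rintro ⟨r', h1, rfl⟩
      rw [← key, ← hq, h1]
    · intro h
      refine ⟨⟨r, by omega⟩, ?_, rfl⟩
      apply Fin.ext
      rw [hq]
      exact (key r).mpr h
  have hdm := Nat.div_add_mod n t
  have hml := Nat.mod_lt n ht
  have h3 : ((i : ℕ) + 1) * n = i * n + n := by ring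
  rw [hcard]
  set u := n / t with hu
  clear_value u A B
  constructor
  · by_contra hcon
    have : (B + 1) * t ≤ (A + u) * t := Nat.mul_le_mul_right _ (by omega)
    rw [add_mul A, mul_comm u] at this
    omega
  · by_contra hcon
    have : (A + 1 + (u + 1)) * t ≤ B * t := Nat.mul_le_mul_right _ (by omega)
    rw [add_mul (A + 1), add_mul u, mul_comm u] at this
    omega

/-- An equitable colouring almost refining a given colouring. -/
lemma equitable {V : Type} [Fintype V] (k t : ℕ) (ht : 0 < t) (htn : t ≤ Fintype.card V)
    (c : V → Fin k) :
    ∃ q : V → Fin t,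
      (∀ i, Fintype.card V / t ≤ (Finset.univ.filter fun x => q x = i).card ∧
        (Finset.univ.filter fun x => q x = i).card ≤ Fintype.card V / t + 1) ∧
      (Finset.univ.filter fun i : Fin t => ¬ ∀ x y, q x = i → q y = i → c x = c y).card ≤ k := by
  set n := Fintype.card V with hn
  have hnpos : 0 < n := lt_of_lt_of_le ht htn
  let e0 : V ≃ Fin n := Fintype.equivFin V
  let s : Equiv.Perm (Fin n) := Tuple.sort (c ∘ e0.symm)
  have hs : Monotone ((c ∘ e0.symm) ∘ s) := Tuple.monotone_sort _
  let e : V ≃ Fin n := e0.trans s.symm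
  have hmono : ∀ x y, e x ≤ e y → c x ≤ c y := by
    intro x y h
    have := hs h
    simpa [e] using this
  let q0 : Fin n → Fin t := fun r => ⟨r * t / n, by
    rw [Nat.div_lt_iff_lt_mul hnpos, mul_comm]
    exact Nat.mul_lt_mul_of_pos_left r.2 ht⟩
  have hq0 : Monotone q0 := by
    intro r r' h
    show (r : ℕ) * t / n ≤ r' * t / n
    exact Nat.div_le_div_right (Nat.mul_le_mul_right _ h)
  refine ⟨fun x => q0 (e x), ?_, ?_⟩
  · intro i
    have h := interval_card n t ht htn i q0 (fun r => rfl)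
    have h2 : (Finset.univ.filter fun x => q0 (e x) = i).card
        = (Finset.univ.filter fun r => q0 r = i).card := by
      rw [← Finset.card_map e.toEmbedding]
      congr 1
      ext r
      simp only [Finset.mem_map, Finset.mem_filter, Finset.mem_univ, true_and,
        Equiv.coe_toEmbedding]
      constructor
      · rintro ⟨x, h, rfl⟩; exact h
      · intro h; exact ⟨e.symm r, by simpa using h, by simp⟩
    rw [h2]; exact h
  · -- inject bad indices into colours
    have hbad : ∀ i : Fin t, (¬ ∀ x y, q0 (e x) = i → q0 (e y) = i → c x = c y) →
        ∃ x y, q0 (e x) = i ∧ q0 (e y) = i ∧ c x < c y := by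
      intro i h
      push Not at h
      obtain ⟨x, y, hx, hy, hne⟩ := h
      rcases lt_or_gt_of_ne hne with h | h
      · exact ⟨x, y, hx, hy, h⟩
      · exact ⟨y, x, hy, hx, h⟩
    have hx : ∀ i : Fin t, ∃ a : Fin k,
        (¬ ∀ x y, q0 (e x) = i → q0 (e y) = i → c x = c y) →
        (∃ x y, q0 (e x) = i ∧ q0 (e y) = i ∧ c x < c y ∧ c x = a) := by
      intro i
      by_cases h : ∀ x y, q0 (e x) = i → q0 (e y) = i → c x = c y
      · have : 0 < Fintype.card V := hnpos
        obtain ⟨v⟩ := Fintype.card_pos_iff.mp this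
        exact ⟨c v, fun h' => absurd h h'⟩
      · obtain ⟨x, y, h1, h2, h3⟩ := hbad i h
        exact ⟨c x, fun _ => ⟨x, y, h1, h2, h3, rfl⟩⟩
    choose F hF using hx
    have hlt : ∀ i j : Fin t, i < j →
        (¬ ∀ x y, q0 (e x) = i → q0 (e y) = i → c x = c y) →
        (¬ ∀ x y, q0 (e x) = j → q0 (e y) = j → c x = c y) → F i < F j := by
      intro i j hij hi hj
      obtain ⟨x, y, h1, h2, h3, h4⟩ := hF i hi
      obtain ⟨x', y', h1', h2', h3', h4'⟩ := hF j hj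
      rw [← h4, ← h4']
      refine lt_of_lt_of_le h3 (hmono _ _ ?_)
      by_contra hcon
      push Not at hcon
      have := hq0 hcon.le
      rw [h2, h1'] at this
      exact absurd hij (not_lt.mpr this)
    calc _ ≤ (Finset.univ : Finset (Fin k)).card := by
          apply Finset.card_le_card_of_injOn F (fun _ _ => Finset.mem_coe.mpr (Finset.mem_univ _))
          intro i hi j hj hij
          simp only [Finset.coe_filter, Finset.mem_univ, true_and, Set.mem_ofPred_eq] at hi hj
          rcases lt_trichotomy i j with h | h | h
          · exact absurd hij (hlt i j h hi hj).ne
          · exact h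
          · exact absurd hij (hlt j i h hj hi).ne'
      _ = k := by simp

/-- The quadratic functional to be increased. -/
noncomputable def quadJ {V : Type} [Fintype V] (G : SimpleGraph V) (g : V × V → ℝ) : ℝ :=
  ∑ z : V × V, (2 * g z * adjInd G z - g z ^ 2)

/-- The colours of the refined colouring. -/
abbrev NextCol (k t : ℕ) : Type :=
  Fin k × Fin t × (Fin t × Fin t → Bool) × (Fin t × Fin t → Bool)

/-- The number of colours of the refined colouring. -/
def nextK (k t : ℕ) : ℕ := Fintype.card (NextCol k t)

/-- The conclusion of the regularity lemma with exactly `t` parts. -/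
def HasRegPartition {V : Type} (G : SimpleGraph V) (ε p : ℝ) (t : ℕ) : Prop :=
  ∃ Q : Fin t → Finset V,
    (∀ i j, i ≠ j → Disjoint (Q i) (Q j)) ∧
    (∀ v, ∃ i, v ∈ Q i) ∧
    (∀ i j, ((Q i).card : ℤ) - ((Q j).card : ℤ) ≤ 1) ∧
    (((Finset.univ.filter (fun ij : Fin t × Fin t =>
        ij.1 ≠ ij.2 ∧ ¬ IsRegularPair G (Q ij.1) (Q ij.2) ε p)).card : ℝ)
      ≤ ε * (t : ℝ) ^ 2)

lemma reg_step {V : Type} [Fintype V] (G : SimpleGraph V) (ε D p η : ℝ) (k t : ℕ)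
    (hε : 0 < ε) (hp : 0 ≤ p) (ht : 0 < t) (hn : 2 * t ≤ Fintype.card V)
    (hk : 4 * (k : ℝ) ≤ ε * t) (hη1 : η ≤ 1 / (2 * t)) (hη2 : η ≤ ε * (1 / (2 * t)))
    (hU : UpperUniform G η p D) (c : V → Fin k) (h : Fin k → Fin k → ℝ)
    (hh : ∀ x y, h (c x) (c y) ≤ D * p) (hno : ¬ HasRegPartition G ε p t) :
    0 < p ∧ ∃ (c' : V → Fin (nextK k t)) (h' : Fin (nextK k t) → Fin (nextK k t) → ℝ),
      (∀ x y, h' (c' x) (c' y) ≤ D * p) ∧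
      quadJ G (fun z => h (c z.1) (c z.2)) + ε ^ 5 / 8 * p ^ 2 * (Fintype.card V : ℝ) ^ 2
        ≤ quadJ G (fun z => h' (c' z.1) (c' z.2)) := by
  obtain ⟨q, hq1, hq2⟩ := equitable k t ht (by omega) c
  set n := Fintype.card V with hnn
  set Q : Fin t → Finset V := fun i => Finset.univ.filter fun x => q x = i with hQ
  have memQ : ∀ i x, x ∈ Q i ↔ q x = i := by intro i x; simp [hQ]
  have hdisj : ∀ i j, i ≠ j → Disjoint (Q i) (Q j) := by
    intro i j hij
    rw [Finset.disjoint_left]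
    intro x hx hx'
    rw [memQ] at hx hx'
    exact hij (hx.symm.trans hx')
  set I : Finset (Fin t × Fin t) := Finset.univ.filter (fun ij : Fin t × Fin t =>
        ij.1 ≠ ij.2 ∧ ¬ IsRegularPair G (Q ij.1) (Q ij.2) ε p) with hI
  have hIcard : ε * (t : ℝ) ^ 2 < I.card := by
    by_contra hcon
    push Not at hcon
    apply hno
    refine ⟨Q, hdisj, fun v => ⟨q v, by rw [memQ]⟩, ?_, hcon⟩
    intro i j
    have h1 := (hq1 i).2
    have h2 := (hq1 j).1
    have h3 : (Q i).card ≤ (Q j).card + 1 := by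
      simp only [hQ]; omega
    omega
  have htR : (0 : ℝ) < t := by exact_mod_cast ht
  have hQsize : ∀ i, (n : ℝ) * (1 / (2 * t)) ≤ (Q i).card := by
    intro i
    have h1 := (hq1 i).1
    have h2 : n < (n / t + 1) * t := by
      have := Nat.lt_div_mul_add (a := n) ht
      rw [add_mul, one_mul]; exact this
    have h3 : n ≤ 2 * t * (Q i).card := by
      have h4 : (n / t + 1) * t ≤ ((Q i).card + 1) * t :=
        Nat.mul_le_mul_right _ (by simp only [hQ]; omega)
      have h5 : n < (Q i).card * t + t := by
        rw [add_mul (Q i).card, one_mul] at h4; omega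
      have h6 : 2 * t * (Q i).card = 2 * ((Q i).card * t) := by ring
      omega
    have h4 : (n : ℝ) ≤ 2 * t * (Q i).card := by exact_mod_cast h3
    rw [mul_one_div, div_le_iff₀ (by positivity)]
    linarith
  have hnR : (0 : ℝ) < n := by
    have : 0 < n := by omega
    exact_mod_cast this
  have hQpos : ∀ i, (0 : ℝ) < (Q i).card := fun i =>
    lt_of_lt_of_le (by positivity) (hQsize i)
  have hηQ : ∀ i, η * n ≤ (Q i).card := by
    intro i
    refine le_trans ?_ (hQsize i)
    rw [mul_comm]
    exact mul_le_mul_of_nonneg_left hη1 hnR.le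
  -- witnesses
  have hw : ∀ ij : Fin t × Fin t, ∃ A B : Finset V, ij ∈ I →
      A ⊆ Q ij.1 ∧ B ⊆ Q ij.2 ∧ ε * (Q ij.1).card ≤ A.card ∧ ε * (Q ij.2).card ≤ B.card ∧
      ε * p < |density G A B - density G (Q ij.1) (Q ij.2)| := by
    intro ij
    by_cases hij : ij ∈ I
    · have := (Finset.mem_filter.mp hij).2.2
      unfold IsRegularPair at this
      push Not at this
      obtain ⟨A, hA, B, hB, h1, h2, h3⟩ := this
      exact ⟨A, B, fun _ => ⟨hA, hB, h1, h2, h3⟩⟩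
    · exact ⟨∅, ∅, fun h => absurd h hij⟩
  choose A B hAB using hw
  set d : Fin t × Fin t → ℝ := fun ij => density G (Q ij.1) (Q ij.2) with hd
  set d' : Fin t × Fin t → ℝ := fun ij => density G (A ij) (B ij) with hd'
  have hdle : ∀ ij ∈ I, d ij ≤ D * p := by
    intro ij hij
    exact hU _ _ (hdisj _ _ (Finset.mem_filter.mp hij).2.1) (hηQ _) (hηQ _)
  have hd'le : ∀ ij ∈ I, d' ij ≤ D * p := by
    intro ij hij
    obtain ⟨h1, h2, h3, h4, -⟩ := hAB ij hij
    have haux : ∀ i, η * n ≤ ε * (Q i).card := by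
      intro i
      calc η * n ≤ (ε * (1 / (2 * t))) * n := mul_le_mul_of_nonneg_right hη2 hnR.le
        _ = ε * (n * (1 / (2 * t))) := by ring
        _ ≤ _ := mul_le_mul_of_nonneg_left (hQsize i) hε.le
    exact hU _ _ (Finset.disjoint_of_subset_left h1 (Finset.disjoint_of_subset_right h2
      (hdisj _ _ (Finset.mem_filter.mp hij).2.1))) ((haux _).trans h3) ((haux _).trans h4)
  have hppos : 0 < p := by
    rcases hp.lt_or_eq with h0 | h0
    · exact h0
    · exfalso
      have hIpos : (0 : ℝ) < I.card := lt_of_le_of_lt (by positivity) hIcard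
      obtain ⟨ij, hij⟩ : I.Nonempty := Finset.card_pos.mp (by exact_mod_cast hIpos)
      have h1 := hdle ij hij
      have h2 := hd'le ij hij
      have h3 := (hAB ij hij).2.2.2.2
      have h4 : 0 ≤ d ij := density_nonneg _ _ _
      have h5 : 0 ≤ d' ij := density_nonneg _ _ _
      rw [← h0, mul_zero] at h1 h2 h3
      have h6 : d' ij - d ij = 0 := by linarith
      simp only [hd, hd'] at h6
      rw [h6, abs_zero] at h3
      exact lt_irrefl _ h3
  refine ⟨hppos, ?_⟩
  set N : Finset (Fin t) :=
    Finset.univ.filter fun i : Fin t => ¬ ∀ x y, q x = i → q y = i → c x = c y with hN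
  set I' : Finset (Fin t × Fin t) := I.filter fun ij => ij.1 ∉ N ∧ ij.2 ∉ N with hI'
  have hI'card : ε * (t : ℝ) ^ 2 / 2 ≤ I'.card := by
    have h1 : I ⊆ I' ∪ (N ×ˢ Finset.univ ∪ Finset.univ ×ˢ N) := by
      intro ij hij
      simp only [Finset.mem_union, Finset.mem_product, Finset.mem_univ, and_true, true_and, hI',
        Finset.mem_filter]
      tauto
    have h2 : I.card ≤ I'.card + (k * t + t * k) := by
      calc I.card ≤ _ := Finset.card_le_card h1
        _ ≤ _ := Finset.card_union_le _ _
        _ ≤ I'.card + (k * t + t * k) := by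
          apply Nat.add_le_add_left
          refine (Finset.card_union_le _ _).trans ?_
          rw [Finset.card_product, Finset.card_product, Finset.card_univ, Fintype.card_fin]
          exact Nat.add_le_add (Nat.mul_le_mul_right _ hq2) (Nat.mul_le_mul_left _ hq2)
    have h3 : (I.card : ℝ) ≤ I'.card + (k * t + t * k) := by exact_mod_cast h2
    nlinarith
  let H : NextCol k t → NextCol k t → ℝ := fun a b =>
    if (a.2.1, b.2.1) ∈ I' then
      (if a.2.2.1 (a.2.1, b.2.1) = true ∧ b.2.2.2 (a.2.1, b.2.1) = true
        then d' (a.2.1, b.2.1) else d (a.2.1, b.2.1))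
    else h a.1 b.1
  let C : V → NextCol k t := fun x =>
    (c x, q x, fun ij => decide (x ∈ A ij), fun ij => decide (x ∈ B ij))
  let E : NextCol k t ≃ Fin (nextK k t) := Fintype.equivFin (NextCol k t)
  have hHC : ∀ x y, H (C x) (C y) = if (q x, q y) ∈ I' then
      (if (x, y) ∈ A (q x, q y) ×ˢ B (q x, q y) then d' (q x, q y) else d (q x, q y))
      else h (c x) (c y) := by
    intro x y
    simp only [H, C, decide_eq_true_eq, Finset.mem_product]
  refine ⟨fun x => E (C x), fun a b => H (E.symm a) (E.symm b), ?_, ?_⟩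
  · intro x y
    simp only [Equiv.symm_apply_apply]
    rw [hHC]
    split_ifs with h1 h2
    · exact hd'le _ (Finset.mem_filter.mp h1).1
    · exact hdle _ (Finset.mem_filter.mp h1).1
    · exact hh x y
  · simp only [Equiv.symm_apply_apply, hHC]
    unfold quadJ
    set δ : ℝ := ε ^ 4 * p ^ 2 * (n * (1 / (2 * t))) ^ 2 with hδ
    have hδ0 : 0 ≤ δ := by positivity
    rw [← Finset.sum_fiberwise (s := (Finset.univ : Finset (V × V)))
      (g := fun z : V × V => (q z.1, q z.2)),
      ← Finset.sum_fiberwise (s := (Finset.univ : Finset (V × V)))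
      (g := fun z : V × V => (q z.1, q z.2))]
    have hblock : ∀ ij : Fin t × Fin t,
        ∑ z ∈ Finset.univ.filter (fun z : V × V => (q z.1, q z.2) = ij),
          (2 * h (c z.1) (c z.2) * adjInd G z - h (c z.1) (c z.2) ^ 2)
          + (if ij ∈ I' then δ else 0) ≤
        ∑ z ∈ Finset.univ.filter (fun z : V × V => (q z.1, q z.2) = ij),
          (2 * (if (q z.1, q z.2) ∈ I' then
      (if (z.1, z.2) ∈ A (q z.1, q z.2) ×ˢ B (q z.1, q z.2)
        then d' (q z.1, q z.2) else d (q z.1, q z.2))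
      else h (c z.1) (c z.2)) * adjInd G z - (if (q z.1, q z.2) ∈ I' then
      (if (z.1, z.2) ∈ A (q z.1, q z.2) ×ˢ B (q z.1, q z.2)
        then d' (q z.1, q z.2) else d (q z.1, q z.2))
      else h (c z.1) (c z.2)) ^ 2) := by
      intro ij
      by_cases hij : ij ∈ I'
      · rw [if_pos hij]
        have hijI := (Finset.mem_filter.mp hij).1
        obtain ⟨hn1, hn2⟩ := (Finset.mem_filter.mp hij).2
        obtain ⟨hA, hB, hA', hB', hgap⟩ := hAB ij hijI
        have hfib : Finset.univ.filter (fun z : V × V => (q z.1, q z.2) = ij)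
            = Q ij.1 ×ˢ Q ij.2 := by
          ext z
          simp only [Finset.mem_filter, Finset.mem_univ, true_and, Finset.mem_product, memQ,
            Prod.ext_iff]
        obtain ⟨x0, hx0⟩ : (Q ij.1).Nonempty :=
          Finset.card_pos.mp (by exact_mod_cast hQpos ij.1)
        obtain ⟨y0, hy0⟩ : (Q ij.2).Nonempty :=
          Finset.card_pos.mp (by exact_mod_cast hQpos ij.2)
        have hm1 : ∀ x y, q x = ij.1 → q y = ij.1 → c x = c y := by
          by_contra hcon
          exact hn1 (Finset.mem_filter.mpr ⟨Finset.mem_univ _, hcon⟩)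
        have hm2 : ∀ x y, q x = ij.2 → q y = ij.2 → c x = c y := by
          by_contra hcon
          exact hn2 (Finset.mem_filter.mpr ⟨Finset.mem_univ _, hcon⟩)
        have hbg := block_gain (Q ij.1 ×ˢ Q ij.2) (A ij ×ˢ B ij)
          (Finset.product_subset_product hA hB) (adjInd G) (d ij) (d' ij) (h (c x0) (c y0))
          (density_mul G _ _) (density_mul G _ _)
        rw [hfib]
        have e1 : ∑ z ∈ Q ij.1 ×ˢ Q ij.2,
            (2 * h (c z.1) (c z.2) * adjInd G z - h (c z.1) (c z.2) ^ 2)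
            = ∑ z ∈ Q ij.1 ×ˢ Q ij.2,
              (2 * h (c x0) (c y0) * adjInd G z - h (c x0) (c y0) ^ 2) := by
          apply Finset.sum_congr rfl
          intro z hz
          rw [Finset.mem_product, memQ, memQ] at hz
          rw [hm1 z.1 x0 hz.1 ((memQ _ _).mp hx0), hm2 z.2 y0 hz.2 ((memQ _ _).mp hy0)]
        rw [e1]
        refine le_trans (add_le_add_right ?_ _) (hbg.trans (le_of_eq ?_))
        · rw [Finset.card_product, Nat.cast_mul]
          have h1 : (ε * p) ^ 2 ≤ (d' ij - d ij) ^ 2 := by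
            rw [← sq_abs (d' ij - d ij)]
            exact pow_le_pow_left₀ (by positivity) hgap.le 2
          have h2 : ε * (n * (1 / (2 * t))) ≤ (A ij).card :=
            (mul_le_mul_of_nonneg_left (hQsize _) hε.le).trans hA'
          have h3 : ε * (n * (1 / (2 * t))) ≤ (B ij).card :=
            (mul_le_mul_of_nonneg_left (hQsize _) hε.le).trans hB'
          calc δ = (ε * (n * (1 / (2 * t)))) * (ε * (n * (1 / (2 * t)))) * (ε * p) ^ 2 := by
                rw [hδ]; ring
            _ ≤ _ := by gcongr
        · apply Finset.sum_congr rfl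
          intro z hz
          rw [Finset.mem_product, memQ, memQ] at hz
          have hz' : (q z.1, q z.2) = ij := Prod.ext hz.1 hz.2
          rw [hz', if_pos hij]
          by_cases hzz : z ∈ A ij ×ˢ B ij
          · rw [if_pos hzz, if_pos hzz]
          · rw [if_neg hzz, if_neg hzz]
      · rw [if_neg hij, add_zero]
        apply le_of_eq
        apply Finset.sum_congr rfl
        intro z hz
        have hz' := (Finset.mem_filter.mp hz).2
        rw [hz', if_neg hij]
    have hsum := Finset.sum_le_sum (s := (Finset.univ : Finset (Fin t × Fin t)))
      fun ij _ => hblock ij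
    rw [Finset.sum_add_distrib] at hsum
    refine le_trans (add_le_add_right ?_ _) hsum
    rw [← Finset.sum_filter, Finset.sum_const, nsmul_eq_mul, Finset.filter_mem_eq_inter,
      Finset.univ_inter]
    calc ε ^ 5 / 8 * p ^ 2 * (n : ℝ) ^ 2 = (ε * (t : ℝ) ^ 2 / 2) * δ := by
          rw [hδ]; field_simp; ring
      _ ≤ _ := mul_le_mul_of_nonneg_right hI'card hδ0

/-- Number of parts used when the current colouring has `k` colours. -/
noncomputable def partsFor (ε : ℝ) (t₀ k : ℕ) : ℕ := t₀ + ⌈4 * (k : ℝ) / ε⌉₊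

/-- Number of colours after `s` steps. -/
noncomputable def colSeq (ε : ℝ) (t₀ : ℕ) : ℕ → ℕ
  | 0 => 1
  | s + 1 => nextK (colSeq ε t₀ s) (partsFor ε t₀ (colSeq ε t₀ s))

lemma singletons_reg {V : Type} [Fintype V] (G : SimpleGraph V) (ε p : ℝ) (hε : 0 < ε)
    (hp : 0 ≤ p) : HasRegPartition G ε p (Fintype.card V) := by
  let e := Fintype.equivFin V
  refine ⟨fun i => {e.symm i}, ?_, fun v => ⟨e v, by simp⟩, by simp, ?_⟩
  · intro i j hij
    simpa using hij
  · rw [Finset.filter_false_of_mem]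
    · simp; positivity
    · rintro ij - ⟨-, h⟩
      apply h
      intro A hA B hB h1 h2
      have key : ∀ (v : V) (S : Finset V), S ⊆ {v} →
          ε * (({v} : Finset V).card : ℝ) ≤ S.card → S = {v} := by
        intro v S hS hc
        rcases Finset.subset_singleton_iff.mp hS with h | h
        · rw [h] at hc
          simp at hc
          linarith
        · exact h
      rw [key _ A hA h1, key _ B hB h2]
      simp
      positivity

lemma quadJ_le {V : Type} [Fintype V] (G : SimpleGraph V) (g : V × V → ℝ) (M : ℝ)
    (hg : ∀ z, g z ≤ M) : quadJ G g ≤ 2 * M * ∑ z : V × V, adjInd G z := by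
  unfold quadJ
  rw [Finset.mul_sum]
  apply Finset.sum_le_sum
  intro z _
  have h1 := mul_le_mul_of_nonneg_right (hg z) (adjInd_nonneg G z)
  nlinarith [sq_nonneg (g z)]

/-- Sparse regularity lemma (Kohayakawa–Rödl). -/
theorem sparse_regularity_lemma (ε D : ℝ) (hε : 0 < ε) (hD : 0 < D) (t₀ : ℕ) (ht₀ : 0 < t₀) :
    ∃ (η : ℝ) (T : ℕ), 0 < η ∧ 0 < T ∧
      ∀ (p : ℝ), 0 ≤ p → p ≤ 1 →
      ∀ (V : Type) [Fintype V], ∀ (G : SimpleGraph V),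
        t₀ ≤ Fintype.card V → UpperUniform G η p D →
        ∃ (t : ℕ) (Q : Fin t → Finset V),
          t₀ ≤ t ∧ t ≤ T ∧
          (∀ i j, i ≠ j → Disjoint (Q i) (Q j)) ∧
          (∀ v, ∃ i, v ∈ Q i) ∧
          (∀ i j, ((Q i).card : ℤ) - ((Q j).card : ℤ) ≤ 1) ∧
          (((Finset.univ.filter (fun ij : Fin t × Fin t =>
              ij.1 ≠ ij.2 ∧ ¬ IsRegularPair G (Q ij.1) (Q ij.2) ε p)).card : ℝ)
            ≤ ε * (t : ℝ) ^ 2) := by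
  set S : ℕ := ⌈2 * D ^ 2 / (ε ^ 5 / 8)⌉₊ + 1 with hS
  set M : ℕ := ∑ s ∈ Finset.range S, partsFor ε t₀ (colSeq ε t₀ s) with hM
  have htpos : ∀ k, 0 < partsFor ε t₀ k := fun k => by unfold partsFor; omega
  have hMle : ∀ s < S, partsFor ε t₀ (colSeq ε t₀ s) ≤ M := by
    intro s hs
    exact Finset.single_le_sum (f := fun s => partsFor ε t₀ (colSeq ε t₀ s))
      (fun _ _ => Nat.zero_le _) (Finset.mem_range.mpr hs)
  have hMpos : 0 < M := lt_of_lt_of_le (htpos _) (hMle 0 (by omega))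
  have hMR : (1 : ℝ) ≤ M := by exact_mod_cast hMpos
  refine ⟨min ε 1 * (1 / (4 * M)), 2 * M + t₀, by positivity, by omega, ?_⟩
  intro p hp0 hp1 V _ G hcard hU
  have hfin : ∀ t, t₀ ≤ t → t ≤ 2 * M + t₀ → HasRegPartition G ε p t → 
      ∃ (t : ℕ) (Q : Fin t → Finset V),
          t₀ ≤ t ∧ t ≤ 2 * M + t₀ ∧
          (∀ i j, i ≠ j → Disjoint (Q i) (Q j)) ∧
          (∀ v, ∃ i, v ∈ Q i) ∧
          (∀ i j, ((Q i).card : ℤ) - ((Q j).card : ℤ) ≤ 1) ∧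
          (((Finset.univ.filter (fun ij : Fin t × Fin t =>
              ij.1 ≠ ij.2 ∧ ¬ IsRegularPair G (Q ij.1) (Q ij.2) ε p)).card : ℝ)
            ≤ ε * (t : ℝ) ^ 2) := by
    rintro t h1 h2 ⟨Q, hQ⟩
    exact ⟨t, Q, h1, h2, hQ⟩
  by_cases hsmall : Fintype.card V ≤ 2 * M
  · exact hfin _ hcard (by omega) (singletons_reg G ε p hε hp0)
  push Not at hsmall
  by_contra hcon
  have hno : ∀ s < S, ¬ HasRegPartition G ε p (partsFor ε t₀ (colSeq ε t₀ s)) := by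
    intro s hs hreg
    refine hcon (hfin _ ?_ ?_ hreg)
    · unfold partsFor; omega
    · have := hMle s hs; omega
  have hηt : ∀ s < S, min ε 1 * (1 / (4 * (M : ℝ))) ≤
      min ε 1 * (1 / (2 * ((partsFor ε t₀ (colSeq ε t₀ s) : ℕ) : ℝ))) := by
    intro s hs
    have h1 : ((partsFor ε t₀ (colSeq ε t₀ s) : ℕ) : ℝ) ≤ M := by exact_mod_cast hMle s hs
    have h2 : (0 : ℝ) < ((partsFor ε t₀ (colSeq ε t₀ s) : ℕ) : ℝ) := by
      exact_mod_cast htpos _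
    apply mul_le_mul_of_nonneg_left _ (by positivity)
    apply one_div_le_one_div_of_le (by positivity)
    linarith
  have step : ∀ s < S, ∀ (c : V → Fin (colSeq ε t₀ s))
      (h : Fin (colSeq ε t₀ s) → Fin (colSeq ε t₀ s) → ℝ),
      (∀ x y, h (c x) (c y) ≤ D * p) → 
      0 < p ∧ ∃ (c' : V → Fin (colSeq ε t₀ (s + 1)))
        (h' : Fin (colSeq ε t₀ (s + 1)) → Fin (colSeq ε t₀ (s + 1)) → ℝ),
      (∀ x y, h' (c' x) (c' y) ≤ D * p) ∧
      quadJ G (fun z => h (c z.1) (c z.2)) + ε ^ 5 / 8 * p ^ 2 * (Fintype.card V : ℝ) ^ 2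
        ≤ quadJ G (fun z => h' (c' z.1) (c' z.2)) := by
    intro s hs c h hh
    have h2 : (0 : ℝ) < ((partsFor ε t₀ (colSeq ε t₀ s) : ℕ) : ℝ) := by
      exact_mod_cast htpos _
    refine reg_step G ε D p _ (colSeq ε t₀ s) (partsFor ε t₀ (colSeq ε t₀ s)) hε hp0 (htpos _)
      ?_ ?_ ((hηt s hs).trans ?_) ((hηt s hs).trans ?_) hU c h hh (hno s hs)
    · have := hMle s hs; omega
    · unfold partsFor
      have h3 := Nat.le_ceil (4 * ((colSeq ε t₀ s : ℕ) : ℝ) / ε)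
      rw [div_le_iff₀ hε] at h3
      push_cast
      nlinarith [mul_nonneg hε.le (Nat.cast_nonneg (α := ℝ) t₀)]
    · have : min ε 1 ≤ 1 := min_le_right _ _
      calc _ ≤ 1 * (1 / (2 * ((partsFor ε t₀ (colSeq ε t₀ s) : ℕ) : ℝ))) :=
            mul_le_mul_of_nonneg_right this (by positivity)
        _ = _ := one_mul _
    · exact mul_le_mul_of_nonneg_right (min_le_left _ _) (by positivity)
  have hDp : 0 ≤ D * p := mul_nonneg hD.le hp0
  have iter : ∀ s ≤ S, ∃ (c : V → Fin (colSeq ε t₀ s))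
      (h : Fin (colSeq ε t₀ s) → Fin (colSeq ε t₀ s) → ℝ),
      (∀ x y, h (c x) (c y) ≤ D * p) ∧
      s * (ε ^ 5 / 8 * p ^ 2 * (Fintype.card V : ℝ) ^ 2)
        ≤ quadJ G (fun z => h (c z.1) (c z.2)) := by
    intro s
    induction s with
    | zero =>
      intro _
      refine ⟨fun _ => (0 : Fin 1), fun _ _ => 0, fun _ _ => hDp, ?_⟩
      simp [quadJ]
    | succ s ih =>
      intro hs
      obtain ⟨c, h, hh, hJ⟩ := ih (by omega)
      obtain ⟨-, c', h', hh', hJ'⟩ := step s (by omega) c h hh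
      refine ⟨c', h', hh', ?_⟩
      push_cast
      linarith
  have hppos : 0 < p := by
    obtain ⟨c, h, hh, -⟩ := iter 0 (by omega)
    exact (step 0 (by omega) c h hh).1
  obtain ⟨c, h, hh, hJ⟩ := iter S le_rfl
  have hJ2 := quadJ_le G (fun z => h (c z.1) (c z.2)) (D * p) (fun z => hh z.1 z.2)
  have hn2 : 2 ≤ Fintype.card V := by omega
  have hη4 : min ε 1 * (1 / (4 * (M : ℝ))) ≤ 1 / 4 := by
    calc _ ≤ 1 * (1 / (4 * (M : ℝ))) :=
          mul_le_mul_of_nonneg_right (min_le_right _ _) (by positivity)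
      _ = 1 / (4 * (M : ℝ)) := one_mul _
      _ ≤ 1 / 4 := one_div_le_one_div_of_le (by norm_num) (by linarith)
  have htot := total_edges G _ p D hη4 hn2 hU
  have hJ3 : 2 * (D * p) * ∑ z : V × V, adjInd G z ≤
      2 * (D * p) * (D * p * (Fintype.card V : ℝ) ^ 2) :=
    mul_le_mul_of_nonneg_left htot (by positivity)
  have hnR : (0 : ℝ) < (Fintype.card V : ℝ) := by
    have : 0 < Fintype.card V := by omega
    exact_mod_cast this
  have hSbig : 2 * D ^ 2 < S * (ε ^ 5 / 8) := by
    have h1 := Nat.le_ceil (2 * D ^ 2 / (ε ^ 5 / 8))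
    rw [← div_lt_iff₀ (by positivity), hS]
    push_cast
    linarith
  have hfinal := mul_lt_mul_of_pos_right hSbig
    (show 0 < p ^ 2 * (Fintype.card V : ℝ) ^ 2 by positivity)
  nlinarith
end

section
/- Hajnal–Szemerédi theorem: For any k ≥ 3, every n-vertex graph G with minimum degree δ(G) ≥ (1 − 1/k)n contains a K_k-factor, provided that n is divisible by k. -/
open Finset Filter
open scoped Classical

namespace HSz

open Relation

section rel
variable {α : Type}

lemma rtg_mono {r p : α → α → Prop} {a b : α} (h : ReflTransGen r a b)
    (hp : ∀ a b, r a b → p a b) : ReflTransGen p a b := by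
  induction h with
  | refl => exact ReflTransGen.refl
  | tail _ h ih => exact ih.tail (hp _ _ h)

lemma avoid_head (r : α → α → Prop) (U t : α) (hne : U ≠ t) (h : ReflTransGen r U t) :
    ∃ d, r U d ∧ d ≠ U ∧ ReflTransGen (fun a b => r a b ∧ a ≠ U ∧ b ≠ U) d t := by
  have key : ∀ c, ReflTransGen r c t →
      (∃ d, r U d ∧ d ≠ U ∧ ReflTransGen (fun a b => r a b ∧ a ≠ U ∧ b ≠ U) d t) ∨
      (c ≠ U ∧ ReflTransGen (fun a b => r a b ∧ a ≠ U ∧ b ≠ U) c t) := by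
    intro c hc
    induction hc using ReflTransGen.head_induction_on with
    | refl => exact Or.inr ⟨hne.symm, ReflTransGen.refl⟩
    | @head a b hab _ ih =>
      rcases ih with ih | ⟨hb, ih⟩
      · exact Or.inl ih
      · by_cases ha : a = U
        · subst ha
          exact Or.inl ⟨b, hab, hb, ih⟩
        · exact Or.inr ⟨ha, ReflTransGen.head ⟨hab, ha, hb⟩ ih⟩
  rcases key U h with h | h
  · exact h
  · exact absurd rfl h.1

lemma avoid_tail (r : α → α → Prop) (c t : α) (hne : c ≠ t) (h : ReflTransGen r c t) :
    ∃ d, r d t ∧ d ≠ t ∧ ReflTransGen (fun a b => r a b ∧ a ≠ t ∧ b ≠ t) c d := by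
  have h' : ReflTransGen (Function.swap r) t c := reflTransGen_swap.mpr h
  obtain ⟨d, hd, hdt, hp⟩ := avoid_head _ t c hne.symm h'
  refine ⟨d, hd, hdt, ?_⟩
  have := reflTransGen_swap.mpr hp
  refine rtg_mono this ?_
  rintro a b ⟨h1, h2, h3⟩
  exact ⟨h1, h3, h2⟩

lemma exists_terminal [Fintype α] (r : α → α → Prop) (cm : α)
    (h : ∃ c, c ≠ cm ∧ ReflTransGen r c cm) :
    ∃ (U : α) (T : Finset α), T.Nonempty ∧ ReflTransGen r U cm ∧ U ∉ T ∧
      (∀ W ∈ T, ReflTransGen r W cm ∧ W ≠ cm ∧ ∀ c, ReflTransGen r c cm → c ≠ W →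
        ReflTransGen (fun a b => r a b ∧ a ≠ W ∧ b ≠ W) c cm) ∧
      (∀ W ∈ T, ∀ d, ReflTransGen r d cm → d ∉ T → d ≠ U → ¬ r W d) := by
  let R : α → α → Prop := fun W c => ReflTransGen (fun a b => r a b ∧ a ≠ W ∧ b ≠ W) c cm
  let T : α → Finset α := fun W => univ.filter fun c => ReflTransGen r c cm ∧ c ≠ W ∧ ¬ R W c
  have hT : ∀ W c, c ∈ T W ↔ ReflTransGen r c cm ∧ c ≠ W ∧ ¬ R W c := by
    intro W c; simp [T]
  let cand : Finset α := univ.filter fun W => ReflTransGen r W cm ∧ (T W).Nonempty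
  have hcand : cand.Nonempty := by
    obtain ⟨c, hc, hr⟩ := h
    refine ⟨cm, ?_⟩
    simp only [cand, mem_filter, mem_univ, true_and]
    refine ⟨ReflTransGen.refl, c, ?_⟩
    rw [hT]
    refine ⟨hr, hc, ?_⟩
    intro hR
    rcases ReflTransGen.cases_tail hR with h | ⟨b, _, hb⟩
    · exact hc h.symm
    · exact hb.2.2 rfl
  obtain ⟨U, hU, hmin⟩ := exists_min_image cand (fun W => (T W).card) hcand
  simp only [cand, mem_filter, mem_univ, true_and] at hU hmin
  refine ⟨U, T U, hU.2, hU.1, ?_, ?_, ?_⟩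
  · rw [hT]; simp
  · intro W hW
    have hW' := (hT _ _).1 hW
    have hWcm : W ≠ cm := by
      rintro rfl
      exact hW'.2.2 ReflTransGen.refl
    refine ⟨hW'.1, hWcm, ?_⟩
    by_contra hcon
    push Not at hcon
    obtain ⟨c, hc, hcW, hcR⟩ := hcon
    have mono : ∀ c, R U c → R W c := by
      intro c hc
      induction hc using ReflTransGen.head_induction_on with
      | refl => exact ReflTransGen.refl
      | @head a b hab hb ih =>
        refine ReflTransGen.head ⟨hab.1, ?_, ?_⟩ ih
        · rintro rfl
          exact hW'.2.2 (ReflTransGen.head hab hb)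
        · rintro rfl
          exact hW'.2.2 hb
    have hRWU : R W U := by
      by_cases hUc : U = cm
      · rw [hUc]
      · obtain ⟨d, hd, hdU, hp⟩ := avoid_head r U cm hUc hU.1
        refine ReflTransGen.head ⟨hd, hW'.2.1.symm, ?_⟩ (mono d hp)
        rintro rfl
        exact hW'.2.2 hp
    have hss : T W ⊂ T U := by
      refine (Finset.ssubset_iff_of_subset ?_).2 ⟨W, hW, ?_⟩
      · intro e he
        rw [hT] at he ⊢
        refine ⟨he.1, ?_, fun h => he.2.2 (mono _ h)⟩
        rintro rfl
        exact he.2.2 hRWU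
      · rw [hT]; simp
    have := hmin W ⟨hW'.1, c, (hT _ _).2 ⟨hc, hcW, hcR⟩⟩
    exact absurd (Finset.card_lt_card hss) (not_lt.2 this)
  · intro W hW d hd hdT hdU hr
    have hW' := (hT _ _).1 hW
    rw [hT] at hdT
    have hRd : R U d := by
      by_contra h
      exact hdT ⟨hd, hdU, h⟩
    exact hW'.2.2 (ReflTransGen.head ⟨hr, hW'.2.1, hdU⟩ hRd)

end rel

set_option linter.unusedSectionVars false
set_option linter.unusedSimpArgs false

section col
variable {V C : Type} [Fintype V] [Fintype C]

def Proper (G : SimpleGraph V) (f : V → C) : Prop := ∀ u v, G.Adj u v → f u ≠ f v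

noncomputable def fib (f : V → C) (c : C) : Finset V := univ.filter (fun v => f v = c)

def Near (G : SimpleGraph V) (s : ℕ) (f : V → C) (cm cp : C) : Prop :=
  Proper G f ∧ cm ≠ cp ∧ (fib f cm).card + 1 = s ∧ (fib f cp).card = s + 1 ∧
    ∀ c, c ≠ cm → c ≠ cp → (fib f c).card = s

def Equit (G : SimpleGraph V) (s : ℕ) (f : V → C) : Prop :=
  Proper G f ∧ ∀ c, (fib f c).card = s

def mov (G : SimpleGraph V) (f : V → C) (c d : C) : Prop :=
  ∃ y, f y = c ∧ ∀ w, G.Adj y w → f w ≠ d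

lemma mem_fib (f : V → C) (c : C) (v : V) : v ∈ fib f c ↔ f v = c := by simp [fib]

lemma proper_update (G : SimpleGraph V) (f : V → C) (y : V) (d : C) (hf : Proper G f)
    (h : ∀ w, G.Adj y w → f w ≠ d) : Proper G (Function.update f y d) := by
  intro u v huv
  have hne := huv.ne
  by_cases hu : u = y
  · subst hu
    rw [Function.update_self, Function.update_of_ne hne.symm]
    exact (h v huv).symm
  · by_cases hv : v = y
    · subst hv
      rw [Function.update_self, Function.update_of_ne hne]
      exact h u huv.symm
    · rw [Function.update_of_ne hu, Function.update_of_ne hv]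
      exact hf u v huv

lemma fib_update_new (f : V → C) (y : V) (d : C) (h : f y ≠ d) :
    (fib (Function.update f y d) d).card = (fib f d).card + 1 := by
  have : fib (Function.update f y d) d = insert y (fib f d) := by
    ext v
    by_cases hv : v = y <;> simp [mem_fib, Function.update_apply, hv]
  rw [this, card_insert_of_notMem]
  simpa [mem_fib] using h

lemma fib_update_old (f : V → C) (y : V) (d : C) (h : f y ≠ d) :
    (fib (Function.update f y d) (f y)).card + 1 = (fib f (f y)).card := by
  have : fib (Function.update f y d) (f y) = (fib f (f y)).erase y := by
    ext v
    by_cases hv : v = y <;> simp [mem_fib, Function.update_apply, hv, h.symm]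
  rw [this]
  exact card_erase_add_one (by simp [mem_fib])

lemma fib_update_other (f : V → C) (y : V) (d c : C) (h : c ≠ f y) (h' : c ≠ d) :
    fib (Function.update f y d) c = fib f c := by
  ext v
  by_cases hv : v = y <;> simp [mem_fib, Function.update_apply, hv, h.symm, h'.symm]

/-- moving a vertex out of the large class (or shifting the surplus) -/
lemma shift (G : SimpleGraph V) (s : ℕ) (cp : C) (n : ℕ) : ∀ (D : Finset C), D.card ≤ n →
    ∀ (f : V → C) (cm : C), Near G s f cm cp →
    ReflTransGen (fun a b => mov G f a b ∧ a ∈ D ∧ b ∈ D) cp cm →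
    ∃ f' : V → C, Equit G s f' := by
  induction n with
  | zero =>
    intro D hD f cm hN hp
    obtain ⟨e, he, -⟩ := avoid_tail _ _ _ hN.2.1.symm hp
    simp at hD
    subst hD
    simp at he
  | succ n ih =>
    intro D hD f cm hN hp
    obtain ⟨e, ⟨⟨y, hy, hyw⟩, heD, hcmD⟩, hecm, hp1⟩ := avoid_tail _ _ _ hN.2.1.symm hp
    obtain ⟨hprop, hne, hcm, hcp, hoth⟩ := hN
    have hpr' := proper_update G f y cm hprop hyw
    have hycm : f y ≠ cm := by rw [hy]; exact hecm
    have h1 := fib_update_new f y cm hycm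
    have h2 := fib_update_old f y cm hycm
    have h3 := fib_update_other f y cm
    rw [hy] at h2
    rw [hy] at h3
    by_cases hecp : e = cp
    · refine ⟨Function.update f y cm, hpr', ?_⟩
      intro c
      by_cases c1 : c = cm
      · subst c1; omega
      · by_cases c2 : c = e
        · subst c2; rw [hecp] at h2 ⊢; omega
        · rw [h3 c c2 c1]
          exact hoth c c1 (hecp ▸ c2)
    · obtain ⟨e', he', he'e, hp2⟩ := avoid_tail _ _ _ (Ne.symm hecp) hp1
      have hm : ∀ a b, mov G f a b → a ≠ e → b ≠ cm → mov G (Function.update f y cm) a b := by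
        rintro a b ⟨x, hx, hxw⟩ hae hbcm
        have hxy : x ≠ y := by rintro rfl; exact hae (hx.symm.trans hy)
        refine ⟨x, by rw [Function.update_of_ne hxy]; exact hx, ?_⟩
        intro w hw
        by_cases hwy : w = y
        · subst hwy; rw [Function.update_self]; exact hbcm.symm
        · rw [Function.update_of_ne hwy]; exact hxw w hw
      refine ih (D.erase cm) ?_ (Function.update f y cm) e ⟨hpr', hecp, ?_, ?_, ?_⟩ ?_
      · have := card_erase_add_one hcmD
        omega
      · rw [h2]; exact hoth e hecm hecp
      · rw [h3 cp (Ne.symm hecp) hne.symm]; exact hcp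
      · intro c ce ccp
        by_cases c1 : c = cm
        · subst c1; omega
        · rw [h3 c ce c1]; exact hoth c c1 ccp
      · refine ReflTransGen.tail (rtg_mono hp2 ?_) ?_
        · rintro a b ⟨⟨⟨h1, h2, h3⟩, h4, h5⟩, h6, h7⟩
          exact ⟨hm a b h1 h6 h5, mem_erase.2 ⟨h4, h2⟩, mem_erase.2 ⟨h5, h3⟩⟩
        · obtain ⟨⟨h1, h2, h3⟩, h4, h5⟩ := he'
          exact ⟨hm _ _ h1 he'e h5, mem_erase.2 ⟨h4, h2⟩, mem_erase.2 ⟨h5, h3⟩⟩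

lemma shift' (G : SimpleGraph V) (s : ℕ) (f : V → C) (cm cp : C) (h : Near G s f cm cp)
    (hp : ReflTransGen (mov G f) cp cm) : ∃ f' : V → C, Equit G s f' :=
  shift G s cp _ univ le_rfl f cm h (by simpa using hp)

noncomputable def dg (G : SimpleGraph V) (v : V) : ℕ := (univ.filter fun w => G.Adj v w).card

noncomputable def dB (G : SimpleGraph V) (f : V → C) (A : Finset C) (v : V) : ℕ :=
  (univ.filter fun w => G.Adj v w ∧ f w ∉ A).card

def Solo (G : SimpleGraph V) (f : V → C) (y z : V) : Prop :=
  G.Adj y z ∧ ∀ w, G.Adj y w → f w = f z → w = z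

lemma dg_split (G : SimpleGraph V) (f : V → C) (A : Finset C) (v : V) :
    (univ.filter fun w => G.Adj v w ∧ f w ∈ A).card + dB G f A v = dg G v := by
  have := card_filter_add_card_filter_not (s := univ.filter fun w => G.Adj v w) (fun w => f w ∈ A)
  simpa only [filter_filter, dB, dg] using this

lemma deg_count (G : SimpleGraph V) (f : V → C) (A D : Finset C) (hD : D ⊆ A) (v : V)
    (h : ∀ d ∈ D, ∃ w, G.Adj v w ∧ f w = d) : D.card + dB G f A v ≤ dg G v := by
  rw [← dg_split G f A v]
  gcongr
  calc D.card ≤ ((univ.filter fun w => G.Adj v w ∧ f w ∈ A).image f).card := by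
        apply card_le_card
        intro d hd
        obtain ⟨w, hw, rfl⟩ := h d hd
        exact mem_image_of_mem _ (by simp [hw, hD hd])
    _ ≤ _ := card_image_le

lemma solo_count (G : SimpleGraph V) (f : V → C) (A T : Finset C) (hT : T ⊆ A) (y : V)
    (h : ∀ d ∈ A, ∃ w, G.Adj y w ∧ f w = d) :
    T.card + A.card + dB G f A y ≤
      dg G y + (univ.filter fun z => f z ∈ T ∧ Solo G f y z).card := by
  rw [← dg_split G f A y]
  have e1 : (univ.filter fun w => G.Adj y w ∧ f w ∈ A).card
      = ∑ d ∈ A, ((univ.filter fun w => G.Adj y w ∧ f w ∈ A).filter fun w => f w = d).card :=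
    card_eq_sum_card_fiberwise (by intro x hx; simpa using (by simpa using hx : _ ∧ _).2)
  have e2 : (univ.filter fun z => f z ∈ T ∧ Solo G f y z).card
      = ∑ d ∈ A, ((univ.filter fun z => f z ∈ T ∧ Solo G f y z).filter fun w => f w = d).card :=
    card_eq_sum_card_fiberwise (by intro x hx; simpa using hT (by simpa using hx : _ ∧ _).1)
  have e3 : T.card = ∑ d ∈ A, if d ∈ T then 1 else 0 := by
    rw [sum_boole]
    simp [filter_mem_eq_inter, inter_eq_right.2 hT]
  have e4 : A.card = ∑ d ∈ A, 1 := by simp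
  have key : T.card + A.card ≤ (univ.filter fun w => G.Adj y w ∧ f w ∈ A).card +
      (univ.filter fun z => f z ∈ T ∧ Solo G f y z).card := by
    rw [e1, e2, ← sum_add_distrib, e3]
    conv_lhs => rw [e4]
    rw [← sum_add_distrib]
    apply sum_le_sum
    intro d hd
    obtain ⟨w, hw, hwd⟩ := h d hd
    have hmem : w ∈ (univ.filter fun w => G.Adj y w ∧ f w ∈ A).filter fun w => f w = d := by
      simp [hw, hwd, hd]
    have hpos := card_pos.2 ⟨w, hmem⟩
    by_cases hdT : d ∈ T
    · rw [if_pos hdT]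
      by_cases hs : ∀ w', G.Adj y w' → f w' = d → w' = w
      · have hmem2 : w ∈ (univ.filter fun z => f z ∈ T ∧ Solo G f y z).filter fun w => f w = d := by
          simp only [mem_filter, mem_univ, true_and]
          refine ⟨⟨hwd ▸ hdT, hw, ?_⟩, hwd⟩
          intro w' h1 h2
          exact hs w' h1 (h2.trans hwd)
        have hpos2 := card_pos.2 ⟨w, hmem2⟩
        omega
      · push Not at hs
        obtain ⟨w', h1, h2, h3⟩ := hs
        have hmem' : w' ∈ (univ.filter fun w => G.Adj y w ∧ f w ∈ A).filter fun w => f w = d := by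
          simp [h1, h2, hd]
        have := one_lt_card.2 ⟨w', hmem', w, hmem, h3⟩
        omega
    · rw [if_neg hdT]; omega
  omega

lemma lemma2 (G : SimpleGraph V) (f : V → C) (A : Finset C) (W : C) (s q t : ℕ)
    (hB : ∀ y, f y ∉ A → ∃ w, G.Adj y w ∧ f w = W)
    (hs : (fib f W).card = s) (hBc : (univ.filter fun y => f y ∉ A).card = q * s + 1)
    (h1 : ∀ z, f z = W → dB G f A z ≤ q + t)
    (h2 : ∀ z y, f z = W → f y ∉ A → Solo G f y z → dB G f A z ≤ q) : q < t := by
  by_contra hcon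
  push Not at hcon
  let φ : V → ℕ := fun z => if ∃ y, f y ∉ A ∧ Solo G f y z then 2 else 1
  have a1 : ∑ y ∈ univ.filter (fun y => f y ∉ A), 2 ≤
      ∑ y ∈ univ.filter (fun y => f y ∉ A), ∑ z ∈ fib f W, if G.Adj y z then φ z else 0 := by
    apply sum_le_sum
    intro y hy
    have hy' : f y ∉ A := by simpa using hy
    obtain ⟨w, hw, hwW⟩ := hB y hy'
    have hwm : w ∈ fib f W := (mem_fib _ _ _).2 hwW
    by_cases hsolo : ∀ w', G.Adj y w' → f w' = W → w' = w
    · have hφ : φ w = 2 := by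
        simp only [φ]
        rw [if_pos]
        exact ⟨y, hy', hw, fun w' p1 p2 => hsolo w' p1 (p2.trans hwW)⟩
      have := single_le_sum (f := fun z => if G.Adj y z then φ z else 0)
        (fun i _ => Nat.zero_le _) hwm
      simp only [hw, if_true, hφ] at this
      exact this
    · push Not at hsolo
      obtain ⟨w', p1, p2, p3⟩ := hsolo
      have hφ : ∀ z, 1 ≤ φ z := by
        intro z; simp only [φ]; split_ifs <;> omega
      have hsub : ({w', w} : Finset V) ⊆ fib f W := by
        intro x hx
        simp only [mem_insert, mem_singleton] at hx
        rcases hx with rfl | rfl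
        · exact (mem_fib _ _ _).2 p2
        · exact hwm
      have := sum_le_sum_of_subset (f := fun z => if G.Adj y z then φ z else 0) hsub
      rw [sum_pair p3] at this
      simp only [hw, p1, if_true] at this
      have q1 := hφ w
      have q2 := hφ w'
      omega
  rw [sum_comm] at a1
  have a2 : ∑ z ∈ fib f W, ∑ y ∈ univ.filter (fun y => f y ∉ A), (if G.Adj y z then φ z else 0)
      ≤ ∑ z ∈ fib f W, 2 * q := by
    apply sum_le_sum
    intro z hz
    have hz' := (mem_fib _ _ _).1 hz
    rw [← sum_filter, sum_const, filter_filter, smul_eq_mul]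
    have e : (univ.filter fun y => f y ∉ A ∧ G.Adj y z).card = dB G f A z := by
      unfold dB
      congr 1
      ext y
      simp [G.adj_comm y z, and_comm]
    rw [e]
    simp only [φ]
    split_ifs with hc
    · obtain ⟨y, hy, hyz⟩ := hc
      have := h2 z y hz' hy hyz
      omega
    · have := h1 z hz'
      omega
  rw [sum_const, hBc, smul_eq_mul] at a1
  rw [sum_const, hs, smul_eq_mul] at a2
  have := a1.trans a2
  nlinarith

lemma weight (G : SimpleGraph V) (f : V → C) (A T : Finset C) (s q : ℕ)
    (hT : T.Nonempty) (hs : ∀ W ∈ T, (fib f W).card = s)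
    (hBc : (univ.filter fun y => f y ∉ A).card = q * s + 1) (hq : q ≤ T.card)
    (hS : ∀ y, f y ∉ A → T.card + (dB G f A y + 1) ≤
      q + (univ.filter fun z => f z ∈ T ∧ Solo G f y z).card)
    (hd : ∀ y, f y ∉ A → dB G f A y + 1 ≤ q)
    (hcl : ∀ z, f z ∈ T → ∀ y1 y2, f y1 ∉ A → f y2 ∉ A → Solo G f y1 z → Solo G f y2 z →
      y1 ≠ y2 → G.Adj y1 y2) : False := by
  let Sz : V → Finset V := fun z => univ.filter fun y => f y ∉ A ∧ Solo G f y z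
  have a1 : ∑ y ∈ univ.filter (fun y => f y ∉ A), (T.card : ℚ) ≤
      ∑ y ∈ univ.filter (fun y => f y ∉ A),
        ∑ z ∈ univ.filter (fun z => f z ∈ T ∧ Solo G f y z), (q : ℚ) / (Sz z).card := by
    apply sum_le_sum
    intro y hy
    have hy' : f y ∉ A := by simpa using hy
    have hb := hd y hy'
    have hb2 := hS y hy'
    set b := dB G f A y + 1 with hbdef
    have hbpos : (0 : ℚ) < b := by exact_mod_cast (by omega : 0 < b)
    have e1 : ∀ z ∈ univ.filter (fun z => f z ∈ T ∧ Solo G f y z),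
        (q : ℚ) / b ≤ (q : ℚ) / (Sz z).card := by
      intro z hz
      simp only [mem_filter, mem_univ, true_and] at hz
      have hymem : y ∈ Sz z := by simp [Sz, hy', hz.2]
      have hpos := card_pos.2 ⟨y, hymem⟩
      have hle : (Sz z).card ≤ b := by
        have h1 := card_erase_add_one hymem
        have h2 : ((Sz z).erase y).card ≤ dB G f A y := by
          apply card_le_card
          intro x hx
          simp only [Sz, mem_erase, mem_filter, mem_univ, true_and] at hx ⊢
          exact ⟨hcl z hz.1 y x hy' hx.2.1 hz.2 hx.2.2 hx.1.symm, hx.2.1⟩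
        omega
      have hpos' : (0 : ℚ) < (Sz z).card := by exact_mod_cast hpos
      have hle' : ((Sz z).card : ℚ) ≤ b := by exact_mod_cast hle
      gcongr
    have e2 := card_nsmul_le_sum _ _ _ e1
    refine le_trans ?_ e2
    rw [nsmul_eq_mul]
    generalize (univ.filter fun z => f z ∈ T ∧ Solo G f y z).card = c at *
    have c1 : (T.card : ℚ) + b ≤ q + c := by exact_mod_cast hb2
    have c2 : (b : ℚ) ≤ q := by exact_mod_cast hb
    have c3 : (q : ℚ) ≤ T.card := by exact_mod_cast hq
    rw [mul_div_assoc', le_div_iff₀ hbpos]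
    nlinarith [mul_nonneg (sub_nonneg.2 c3) (sub_nonneg.2 c2)]
  have a2 : ∑ y ∈ univ.filter (fun y => f y ∉ A),
        ∑ z ∈ univ.filter (fun z => f z ∈ T ∧ Solo G f y z), (q : ℚ) / (Sz z).card
      = ∑ z ∈ univ.filter (fun z => f z ∈ T), ∑ y ∈ Sz z, (q : ℚ) / (Sz z).card := by
    apply sum_comm'
    intro y z
    simp only [Sz, mem_filter, mem_univ, true_and]
    tauto
  have a3 : ∑ z ∈ univ.filter (fun z => f z ∈ T), ∑ y ∈ Sz z, (q : ℚ) / (Sz z).card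
      ≤ ∑ z ∈ univ.filter (fun z => f z ∈ T), (q : ℚ) := by
    apply sum_le_sum
    intro z _
    rw [sum_const, nsmul_eq_mul]
    by_cases h0 : (Sz z).card = 0
    · simp [h0]
    · have : ((Sz z).card : ℚ) ≠ 0 := by exact_mod_cast h0
      rw [mul_div_cancel₀ _ this]
  have e : (univ.filter (fun z => f z ∈ T)).card = T.card * s := by
    rw [card_eq_sum_card_fiberwise (f := f) (t := T) (by intro x hx; simpa using hx),
      ← smul_eq_mul, ← sum_const]
    apply sum_congr rfl
    intro W hW
    rw [← hs W hW]
    congr 1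
    ext x
    simp only [mem_filter, mem_univ, true_and, mem_fib]
    constructor
    · exact fun h => h.2
    · exact fun h => ⟨h ▸ hW, h⟩
  rw [a2] at a1
  have a4 := a1.trans a3
  rw [sum_const, sum_const, hBc, e, nsmul_eq_mul, nsmul_eq_mul] at a4
  have ht : 0 < T.card := card_pos.2 hT
  have a5 : (q * s + 1) * T.card ≤ T.card * s * q := by exact_mod_cast a4
  nlinarith

noncomputable def recol (A : Finset C) (f g : V → C) (z y : V) (P W : C) (v : V) : C :=
  if v = z then P else if v = y then W else if f v ∈ A then f v else g v

lemma recol_proper (G : SimpleGraph V) (A : Finset C) (f g : V → C) (z y : V) (P W : C)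
    (hf : Proper G f) (hz : f z = W) (hW : W ∈ A) (hsolo : Solo G f y z)
    (hg : ∀ v, f v ∉ A → v ≠ y → g v ∉ A)
    (hgp : ∀ u v, f u ∉ A → u ≠ y → f v ∉ A → v ≠ y → G.Adj u v → g u ≠ g v)
    (hP : ∀ w, w ≠ z → G.Adj z w → recol A f g z y P W w ≠ P) :
    Proper G (recol A f g z y P W) := by
  have hfz : recol A f g z y P W z = P := by simp [recol]
  have hyw : ∀ w, w ≠ z → w ≠ y → G.Adj y w → recol A f g z y P W w ≠ W := by
    intro w h1 h2 h3
    simp only [recol, if_neg h1, if_neg h2]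
    split_ifs with h
    · intro h4
      exact h1 (hsolo.2 w h3 (h4.trans hz.symm))
    · intro h4
      exact hg w h h2 (h4 ▸ hW)
  have hyz : y ≠ z := hsolo.1.ne
  have hfy : recol A f g z y P W y = W := by simp [recol, hyz]
  intro u v huv
  by_cases hu : u = z
  · subst hu
    rw [hfz]
    exact (hP v huv.ne.symm huv).symm
  by_cases hv : v = z
  · subst hv
    rw [hfz]
    exact hP u hu huv.symm
  by_cases hu' : u = y
  · subst hu'
    rw [hfy]
    exact (hyw v hv huv.ne.symm huv).symm
  by_cases hv' : v = y
  · subst hv'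
    rw [hfy]
    exact hyw u hu hu' huv.symm
  simp only [recol, if_neg hu, if_neg hu', if_neg hv, if_neg hv']
  split_ifs with h1 h2 h2
  · exact hf u v huv
  · intro h; exact hg v h2 hv' (h ▸ h1)
  · intro h; exact hg u h1 hu' (h ▸ h2)
  · exact hgp u v h1 hu' h2 hv' huv

lemma recol_fib1 (A : Finset C) (f g : V → C) (z y : V) (P W : C)
    (hz : f z = W) (hy : f y ∉ A) (hyz : y ≠ z)
    (hg : ∀ v, f v ∉ A → v ≠ y → g v ∉ A) (c : C) (hc : c ∈ A) (hcP : c ≠ P) :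
    (fib (recol A f g z y P W) c).card = (fib f c).card := by
  by_cases hcW : c = W
  · have hzm : z ∈ fib f c := (mem_fib _ _ _).2 (hz.trans hcW.symm)
    have hym : y ∉ (fib f c).erase z := by
      intro h
      have := (mem_fib _ _ _).1 (mem_of_mem_erase h)
      exact hy (this ▸ hc)
    have e : fib (recol A f g z y P W) c = insert y ((fib f c).erase z) := by
      ext v
      simp only [mem_fib, recol, mem_insert, mem_erase]
      by_cases h1 : v = z
      · subst h1; simp [hcP.symm, hyz.symm]
      · by_cases h2 : v = y
        · subst h2; simp [h1, hcW]
        · by_cases h3 : f v ∈ A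
          · simp [h1, h2, h3]
          · simp only [h1, h2, h3, if_false]
            have := hg v h3 h2
            constructor
            · intro h; exact absurd hc (h ▸ this)
            · rintro (h | h)
              · exact absurd h (by simp)
              · exact absurd hc (h.2 ▸ h3)
    rw [e, card_insert_of_notMem hym, card_erase_add_one hzm]
  · congr 1
    ext v
    simp only [mem_fib, recol]
    by_cases h1 : v = z
    · subst h1; simp [hcP.symm, hz, Ne.symm hcW]
    · by_cases h2 : v = y
      · subst h2
        simp only [h1, if_true, if_false]
        constructor
        · intro h; exact absurd h.symm hcW
        · intro h; exact absurd hc (h ▸ hy)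
      · by_cases h3 : f v ∈ A
        · simp [h1, h2, h3]
        · simp only [h1, h2, h3, if_false]
          have := hg v h3 h2
          constructor
          · intro h; exact absurd hc (h ▸ this)
          · intro h; exact absurd hc (h ▸ h3)

lemma recol_fib2 (A : Finset C) (f g : V → C) (z y : V) (P W : C)
    (hz : f z = W) (hW : W ∈ A)
    (c : C) (hc : c ∉ A) (hcP : c ≠ P) :
    (fib (recol A f g z y P W) c).card =
      (univ.filter fun v => (f v ∉ A ∧ v ≠ y) ∧ g v = c).card := by
  congr 1
  ext v
  simp only [mem_fib, recol, mem_filter, mem_univ, true_and]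
  by_cases h1 : v = z
  · subst h1; simp [hcP.symm, hz, hW]
  · by_cases h2 : v = y
    · subst h2
      simp only [h1, if_true, if_false]
      constructor
      · intro h; exact absurd hW (h ▸ hc)
      · intro h; exact absurd rfl h.1.2
    · by_cases h3 : f v ∈ A
      · simp only [h1, h2, h3, if_true, if_false]
        constructor
        · intro h; exact absurd h3 (h ▸ hc)
        · intro h; exact absurd trivial h.1.1
      · simp [h1, h2, h3]

lemma recol_fib3 (A : Finset C) (f g : V → C) (z y : V) (P W : C)
    (hz : f z = W) (hy : f y ∉ A) (hPW : P ≠ W)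
    (hg : ∀ v, f v ∉ A → v ≠ y → g v ∉ A) (hP : P ∈ A) :
    (fib (recol A f g z y P W) P).card = (fib f P).card + 1 := by
  have hzm : z ∉ fib f P := by
    intro h
    exact hPW (((mem_fib _ _ _).1 h).symm.trans hz)
  rw [← card_insert_of_notMem hzm]
  congr 1
  ext v
  simp only [mem_fib, recol, mem_insert]
  by_cases h1 : v = z
  · simp [h1]
  · by_cases h2 : v = y
    · subst h2
      simp only [h1, if_true, if_false, false_or]
      constructor
      · intro h; exact absurd h.symm hPW
      · intro h; exact absurd hP (h ▸ hy)
    · by_cases h3 : f v ∈ A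
      · simp [h1, h2, h3]
      · simp only [h1, h2, h3, if_false, false_or]
        have := hg v h3 h2
        constructor
        · intro h; exact absurd hP (h ▸ this)
        · intro h; exact absurd hP (h ▸ h3)

lemma recol_fib4 (A : Finset C) (f g : V → C) (z y : V) (P W : C)
    (hz : f z = W) (hW : W ∈ A) (hP : P ∉ A) :
    (fib (recol A f g z y P W) P).card =
      (univ.filter fun v => (f v ∉ A ∧ v ≠ y) ∧ g v = P).card + 1 := by
  have hzm : z ∉ (univ.filter fun v => (f v ∉ A ∧ v ≠ y) ∧ g v = P) := by
    simp [hz, hW]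
  rw [← card_insert_of_notMem hzm]
  congr 1
  ext v
  simp only [mem_fib, recol, mem_insert, mem_filter, mem_univ, true_and]
  by_cases h1 : v = z
  · simp [h1]
  · by_cases h2 : v = y
    · subst h2
      simp only [h1, if_true, if_false, false_or]
      constructor
      · intro h; exact absurd hW (h ▸ hP)
      · intro h; exact absurd rfl h.1.2
    · by_cases h3 : f v ∈ A
      · simp only [h1, h2, h3, if_true, if_false, false_or]
        constructor
        · intro h; exact absurd h3 (h ▸ hP)
        · intro h; exact absurd trivial h.1.1
      · simp [h1, h2, h3]

/-- movability inside the accessible part survives the recolouring -/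
lemma recol_mov (G : SimpleGraph V) (A : Finset C) (f g : V → C) (z y : V) (P W : C)
    (hy : f y ∉ A) (hg : ∀ v, f v ∉ A → v ≠ y → g v ∉ A) (a b : C) (x : V)
    (hx : f x = a) (hxz : x ≠ z) (ha : a ∈ A) (hb : b ∈ A) (hbW : b ≠ W)
    (hbP : b ≠ P) (hxw : ∀ w, G.Adj x w → f w ≠ b) :
    mov G (recol A f g z y P W) a b := by
  have hxy : x ≠ y := by rintro rfl; exact hy (hx ▸ ha)
  refine ⟨x, ?_, ?_⟩
  · simp [recol, hxz, hxy, hx, ha]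
  · intro w hw
    simp only [recol]
    split_ifs with h1 h2 h3
    · exact hbP.symm
    · exact hbW.symm
    · exact hxw w hw
    · intro h; exact hg w h3 h2 (h ▸ hb)

noncomputable def acc (G : SimpleGraph V) (f : V → C) (cm : C) : Finset C :=
  univ.filter fun c => ReflTransGen (mov G f) c cm

lemma mem_acc (G : SimpleGraph V) (f : V → C) (cm c : C) :
    c ∈ acc G f cm ↔ ReflTransGen (mov G f) c cm := by simp [acc]

lemma not_acc (G : SimpleGraph V) (f : V → C) (cm : C) (y : V) (hy : f y ∉ acc G f cm) :
    ∀ d ∈ acc G f cm, ∃ w, G.Adj y w ∧ f w = d := by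
  intro d hd
  by_contra h
  push Not at h
  rw [mem_acc] at hy hd
  exact hy (ReflTransGen.head ⟨y, rfl, h⟩ hd)

lemma card_B (G : SimpleGraph V) (s : ℕ) (f : V → C) (cm cp : C) (hN : Near G s f cm cp)
    (A : Finset C) (hcm : cm ∈ A) (hcp : cp ∉ A) :
    (univ.filter fun y => f y ∉ A).card = (univ \ A).card * s + 1 := by
  rw [card_eq_sum_card_fiberwise (f := f) (t := univ \ A) (by intro x hx; simpa using hx)]
  have : ∀ c ∈ univ \ A, ((univ.filter fun y => f y ∉ A).filter fun v => f v = c).card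
      = s + if c = cp then 1 else 0 := by
    intro c hc
    have hcA : c ∉ A := by simpa using hc
    have e : ((univ.filter fun y => f y ∉ A).filter fun v => f v = c) = fib f c := by
      ext v
      simp only [mem_filter, mem_univ, true_and, mem_fib]
      exact ⟨fun h => h.2, fun h => ⟨h ▸ hcA, h⟩⟩
    rw [e]
    by_cases h : c = cp
    · subst h; simpa using hN.2.2.2.1
    · rw [if_neg h]
      exact hN.2.2.2.2 c (by rintro rfl; exact hcA hcm) h
  rw [sum_congr rfl this, sum_add_distrib, sum_const, smul_eq_mul, sum_ite_eq', if_pos]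
  simpa using hcp

lemma exists_acc (G : SimpleGraph V) (s : ℕ) (f : V → C) (cm cp : C) (hN : Near G s f cm cp)
    (hdeg : ∀ v, dg G v < Fintype.card C) (hcp : cp ∉ acc G f cm) :
    ∃ c, c ≠ cm ∧ ReflTransGen (mov G f) c cm := by
  by_contra hcon
  push Not at hcon
  have hA : acc G f cm = {cm} := by
    ext c
    rw [mem_acc, mem_singleton]
    constructor
    · intro h
      by_contra h'
      exact hcon c h' h
    · rintro rfl; exact ReflTransGen.refl
  have hcm : cm ∈ acc G f cm := by rw [hA]; simp
  have hB := card_B G s f cm cp hN _ hcm hcp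
  have hsub : (univ.filter fun y => f y ∉ acc G f cm) ⊆
      (fib f cm).biUnion fun z => univ.filter fun w => G.Adj z w := by
    intro y hy
    have hy' : f y ∉ acc G f cm := by simpa using hy
    obtain ⟨w, hw, hwc⟩ := not_acc G f cm y hy' cm hcm
    rw [mem_biUnion]
    exact ⟨w, (mem_fib _ _ _).2 hwc, by simpa using hw.symm⟩
  have h1 := (card_le_card hsub).trans (card_biUnion_le_card_mul _ _ (Fintype.card C - 1)
    (fun z _ => by have := hdeg z; unfold dg at this; omega))
  rw [hB, hA, card_sdiff_of_subset (subset_univ _), card_singleton, card_univ] at h1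
  have h2 := hN.2.2.1
  generalize Fintype.card C - 1 = q at *
  rw [← h2] at h1
  nlinarith

def SetHyp (G : SimpleGraph V) (C : Type) (s q : ℕ) : Prop :=
  ∀ (S : Finset V) (D : Finset C) (_ : V → C), D.card = q → S.card = q * s →
    (∀ v ∈ S, (univ.filter fun w => G.Adj v w ∧ w ∈ S).card < q) →
    ∃ g : V → C, (∀ v ∈ S, g v ∈ D) ∧ (∀ u ∈ S, ∀ v ∈ S, G.Adj u v → g u ≠ g v) ∧
      ∀ c ∈ D, (univ.filter fun v => v ∈ S ∧ g v = c).card = s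

lemma near_step (G : SimpleGraph V) (s : ℕ) (hdeg : ∀ v, dg G v < Fintype.card C)
    (IH : ∀ q < Fintype.card C, SetHyp G C s q) (f : V → C) (cm cp : C)
    (hN : Near G s f cm cp) :
    (∃ f' : V → C, Equit G s f') ∨
    ∃ (f' : V → C) (cp' : C), Near G s f' cm cp' ∧ (acc G f cm).card < (acc G f' cm).card := by
  by_cases hcp : cp ∈ acc G f cm
  · exact Or.inl (shift' G s f cm cp hN ((mem_acc _ _ _ _).1 hcp))
  obtain ⟨U, T, hTne, hU, hUT, hTW, hTd⟩ :=
    exists_terminal (mov G f) cm (exists_acc G s f cm cp hN hdeg hcp)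
  set A := acc G f cm with hAdef
  have hmA : ∀ c, c ∈ A ↔ ReflTransGen (mov G f) c cm := mem_acc G f cm
  have hcm : cm ∈ A := (hmA _).2 ReflTransGen.refl
  have hUA : U ∈ A := (hmA _).2 hU
  have hTA : T ⊆ A := fun W hW => (hmA _).2 (hTW W hW).1
  have hBn := not_acc G f cm
  rw [← hAdef] at hBn
  have hBc := card_B G s f cm cp hN A hcm hcp
  have hqA : (univ \ A).card + A.card = Fintype.card C := by
    rw [card_sdiff_add_card_eq_card (subset_univ _), card_univ]
  set q := (univ \ A).card with hq
  have hA1 : 0 < A.card := card_pos.2 ⟨cm, hcm⟩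
  have hdB : ∀ y, f y ∉ A → dB G f A y + 1 ≤ q := by
    intro y hy
    have h1 := deg_count G f A A (Subset.refl _) y (hBn y hy)
    have h2 := hdeg y
    omega
  have hTs : ∀ W ∈ T, (fib f W).card = s := by
    intro W hW
    exact hN.2.2.2.2 W (hTW W hW).2.1 (by rintro rfl; exact hcp (hTA hW))
  -- the colouring of `B` minus a vertex
  have hcolB : ∀ y, f y ∉ A → ∃ g : V → C, (∀ v, f v ∉ A → v ≠ y → g v ∉ A) ∧
      (∀ u v, f u ∉ A → u ≠ y → f v ∉ A → v ≠ y → G.Adj u v → g u ≠ g v) ∧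
      ∀ c, c ∉ A → (univ.filter fun v => (f v ∉ A ∧ v ≠ y) ∧ g v = c).card = s := by
    intro y hy
    have hyB : y ∈ univ.filter fun v => f v ∉ A := by simpa using hy
    obtain ⟨g, g1, g2, g3⟩ := IH q (by omega) ((univ.filter fun v => f v ∉ A).erase y) (univ \ A) f
      rfl (by have := card_erase_add_one hyB; omega) (by
        intro v hv
        have hvA : f v ∉ A := by
          have := mem_of_mem_erase hv
          simpa using this
        have h1 := hdB v hvA
        have h2 : (univ.filter fun w => G.Adj v w ∧ w ∈ (univ.filter fun v => f v ∉ A).erase y).card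
            ≤ dB G f A v := by
          unfold dB
          apply card_le_card
          intro w hw
          simp only [mem_filter, mem_univ, true_and, mem_erase] at hw ⊢
          exact ⟨hw.1, hw.2.2⟩
        omega)
    refine ⟨g, ?_, ?_, ?_⟩
    · intro v h1 h2
      have := g1 v (by simp [h1, h2])
      simpa using this
    · intro u v h1 h2 h3 h4 h5
      exact g2 u (by simp [h1, h2]) v (by simp [h3, h4]) h5
    · intro c hc
      rw [← g3 c (by simpa using hc)]
      congr 1
      ext v
      simp only [mem_filter, mem_univ, true_and, mem_erase]
      tauto
  by_cases hmovable : ∃ z y X, f z ∈ T ∧ f y ∉ A ∧ Solo G f y z ∧ X ∈ A ∧ X ≠ f z ∧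
      ∀ w, G.Adj z w → f w ≠ X
  · -- Case 1
    left
    obtain ⟨z, y, X, hzT, hy, hsolo, hXA, hXW, hzX⟩ := hmovable
    obtain ⟨g, g1, g2, g3⟩ := hcolB y hy
    have hyz := hsolo.1.ne
    have hWA := hTA hzT
    have hWcm := (hTW _ hzT).2.1
    have hprop : Proper G (recol A f g z y X (f z)) := by
      apply recol_proper G A f g z y X (f z) hN.1 rfl hWA hsolo g1 g2
      intro w hwz hw
      simp only [recol, if_neg hwz]
      split_ifs with h1 h2
      · exact hXW.symm
      · exact hzX w hw
      · intro h; exact g1 w h2 h1 (h ▸ hXA)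
    have F1 := recol_fib1 A f g z y X (f z) rfl hy hyz g1
    have F2 := recol_fib2 A f g z y X (f z) rfl hWA
    have F3 := recol_fib3 A f g z y X (f z) rfl hy hXW g1 hXA
    have Fo : ∀ c, c ≠ cm → c ≠ X → (fib (recol A f g z y X (f z)) c).card = s := by
      intro c c1 c2
      by_cases hc : c ∈ A
      · rw [F1 c hc c2]
        exact hN.2.2.2.2 c c1 (by rintro rfl; exact hcp hc)
      · rw [F2 c hc c2]; exact g3 c hc
    by_cases hXcm : X = cm
    · refine ⟨_, hprop, ?_⟩
      intro c
      by_cases hc : c = cm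
      · rw [hc, ← hXcm, F3, hXcm]; exact hN.2.2.1
      · exact Fo c hc (hXcm ▸ hc)
    · have hXs : (fib f X).card = s := hN.2.2.2.2 X hXcm (by rintro rfl; exact hcp hXA)
      refine shift' G s (recol A f g z y X (f z)) cm X ⟨hprop, Ne.symm hXcm, ?_, ?_, Fo⟩ ?_
      · rw [F1 cm hcm (Ne.symm hXcm)]; exact hN.2.2.1
      · rw [F3, hXs]
      · have hp := (hTW _ hzT).2.2 X ((hmA _).1 hXA) hXW
        obtain ⟨d, hd, hdX, hp2⟩ := avoid_head _ _ _ hXcm hp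
        have hacc : ∀ c, ReflTransGen (fun a b => (mov G f a b ∧ a ≠ f z ∧ b ≠ f z) ∧ a ≠ X ∧ b ≠ X)
            c cm → c ∈ A ∧ ReflTransGen (mov G (recol A f g z y X (f z))) c cm := by
          intro c hc
          induction hc using ReflTransGen.head_induction_on with
          | refl => exact ⟨hcm, ReflTransGen.refl⟩
          | @head a b hab _ ih =>
            obtain ⟨⟨⟨x, hx, hxw⟩, ha, hb⟩, haX, hbX⟩ := hab
            have haA : a ∈ A := (hmA _).2 (ReflTransGen.head ⟨x, hx, hxw⟩ ((hmA _).1 ih.1))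
            refine ⟨haA, ReflTransGen.head ?_ ih.2⟩
            refine recol_mov G A f g z y X (f z) hy g1 a b x hx ?_ haA ih.1 hb hbX hxw
            rintro rfl; exact ha hx.symm
        obtain ⟨hdA, hdp⟩ := hacc d hp2
        refine ReflTransGen.head ?_ hdp
        obtain ⟨⟨x, hx, hxw⟩, ha, hb⟩ := hd
        refine recol_mov G A f g z y X (f z) hy g1 X d x hx ?_ hXA hdA hb hdX hxw
        rintro rfl; exact ha hx.symm
  · -- Case 2
    right
    have hNM : ∀ z y, f z ∈ T → f y ∉ A → Solo G f y z → ∀ X ∈ A, X ≠ f z →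
        ∃ w, G.Adj z w ∧ f w = X := by
      intro z y h1 h2 h3 X h4 h5
      by_contra h6
      push Not at h6
      exact hmovable ⟨z, y, X, h1, h2, h3, h4, h5, h6⟩
    have hdz : ∀ z y, f z ∈ T → f y ∉ A → Solo G f y z → dB G f A z ≤ q := by
      intro z y h1 h2 h3
      have h4 := deg_count G f A (A.erase (f z)) (erase_subset _ _) z (by
        intro d hd
        rw [mem_erase] at hd
        exact hNM z y h1 h2 h3 d hd.2 hd.1)
      have h5 := card_erase_add_one (hTA h1)
      have h6 := hdeg z
      omega
    have hqT : q < T.card := by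
      obtain ⟨W, hW⟩ := hTne
      refine lemma2 G f A W s q T.card (fun y hy => hBn y hy W (hTA hW)) (hTs W hW) hBc ?_ ?_
      · intro z hz
        have hUT' : U ∉ T := hUT
        have h1 : insert U T ⊆ A := insert_subset hUA hTA
        have h2 := deg_count G f A (A \ insert U T) sdiff_subset z (by
          intro d hd
          rw [Finset.mem_sdiff, Finset.mem_insert, not_or] at hd
          by_contra h
          push Not at h
          exact hTd W hW d ((hmA _).1 hd.1) hd.2.2 hd.2.1 ⟨z, hz, h⟩)
        have h3 := card_sdiff_add_card_eq_card h1
        rw [card_insert_of_notMem hUT] at h3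
        have h4 := hdeg z
        omega
      · intro z y hz hy hs
        exact hdz z y (hz ▸ hW) hy hs
    have hnc : ∃ z y1 y2, f z ∈ T ∧ f y1 ∉ A ∧ f y2 ∉ A ∧ Solo G f y1 z ∧ Solo G f y2 z ∧
        y1 ≠ y2 ∧ ¬ G.Adj y1 y2 := by
      by_contra hcon
      refine weight G f A T s q hTne hTs hBc hqT.le ?_ hdB ?_
      · intro y hy
        have h1 := solo_count G f A T hTA y (hBn y hy)
        have h2 := hdeg y
        omega
      · intro z hz y1 y2 h1 h2 h3 h4 h5
        by_contra h6
        exact hcon ⟨z, y1, y2, hz, h1, h2, h3, h4, h5, h6⟩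
    obtain ⟨z, y, y2, hzT, hy, hy2, hsolo, hsolo2, hyy, hnadj⟩ := hnc
    obtain ⟨g, g1, g2, g3⟩ := hcolB y hy
    have hyz := hsolo.1.ne
    have hWA := hTA hzT
    have hWcm := (hTW _ hzT).2.1
    -- a colour for `z`
    obtain ⟨Y, hYA, hY⟩ : ∃ Y, Y ∉ A ∧ ∀ w, f w ∉ A → w ≠ y → G.Adj z w → g w ≠ Y := by
      by_contra hcon
      push Not at hcon
      have hyN : y ∈ univ.filter fun w => G.Adj z w ∧ f w ∉ A := by
        simp [hy, hsolo.1.symm]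
      have hsub : univ \ A ⊆ ((univ.filter fun w => G.Adj z w ∧ f w ∉ A).erase y).image g := by
        intro c hc
        obtain ⟨w, w1, w2, w3, w4⟩ := hcon c (by simpa using hc)
        rw [mem_image]
        exact ⟨w, by simp [w1, w2, w3], w4⟩
      have h1 := (card_le_card hsub).trans card_image_le
      have h2 := card_erase_add_one hyN
      have h3 := hdz z y hzT hy hsolo
      unfold dB at h3
      omega
    have hYW : Y ≠ f z := by rintro rfl; exact hYA hWA
    have hYcm : Y ≠ cm := by rintro rfl; exact hYA hcm
    have hprop : Proper G (recol A f g z y Y (f z)) := by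
      apply recol_proper G A f g z y Y (f z) hN.1 rfl hWA hsolo g1 g2
      intro w hwz hw
      simp only [recol, if_neg hwz]
      split_ifs with h1 h2
      · exact hYW.symm
      · intro h; exact hYA (h ▸ h2)
      · exact hY w h2 h1 hw
    have F1 := recol_fib1 A f g z y Y (f z) rfl hy hyz g1
    have F2 := recol_fib2 A f g z y Y (f z) rfl hWA
    have F4 := recol_fib4 A f g z y Y (f z) rfl hWA hYA
    refine ⟨recol A f g z y Y (f z), Y, ⟨hprop, hYcm.symm, ?_, ?_, ?_⟩, ?_⟩
    · rw [F1 cm hcm hYcm.symm]; exact hN.2.2.1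
    · rw [F4, g3 Y hYA]
    · intro c c1 c2
      by_cases hc : c ∈ A
      · rw [F1 c hc c2]
        exact hN.2.2.2.2 c c1 (by rintro rfl; exact hcp hc)
      · rw [F2 c hc c2]; exact g3 c hc
    · have hAY : ∀ b ∈ A, b ≠ Y := by rintro b hb rfl; exact hYA hb
      have hacc : ∀ c, ReflTransGen (fun a b => mov G f a b ∧ a ≠ f z ∧ b ≠ f z)
          c cm → c ∈ A ∧ ReflTransGen (mov G (recol A f g z y Y (f z))) c cm := by
        intro c hc
        induction hc using ReflTransGen.head_induction_on with
        | refl => exact ⟨hcm, ReflTransGen.refl⟩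
        | @head a b hab _ ih =>
          obtain ⟨⟨x, hx, hxw⟩, ha, hb⟩ := hab
          have haA : a ∈ A := (hmA _).2 (ReflTransGen.head ⟨x, hx, hxw⟩ ((hmA _).1 ih.1))
          refine ⟨haA, ReflTransGen.head ?_ ih.2⟩
          refine recol_mov G A f g z y Y (f z) hy g1 a b x hx ?_ haA ih.1 hb (hAY b ih.1) hxw
          rintro rfl; exact ha hx.symm
      have hWacc : ReflTransGen (mov G (recol A f g z y Y (f z))) (f z) cm := by
        obtain ⟨d, ⟨x, hx, hxw⟩, hdW, hdp⟩ := avoid_head _ _ _ hWcm ((hmA _).1 hWA)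
        obtain ⟨hdA, hdp'⟩ := hacc d hdp
        refine ReflTransGen.head ?_ hdp'
        refine recol_mov G A f g z y Y (f z) hy g1 (f z) d x hx ?_ hWA hdA hdW (hAY d hdA) hxw
        rintro rfl
        obtain ⟨w, w1, w2⟩ := hNM x y hzT hy hsolo d hdA hdW
        exact hxw w w1 w2
      have hy2z := hsolo2.1.ne
      have hcol2 : recol A f g z y Y (f z) y2 = g y2 := by
        simp [recol, hy2z, hyy.symm, hy2]
      have hg2 : g y2 ∉ A := g1 y2 hy2 hyy.symm
      have hmov2 : mov G (recol A f g z y Y (f z)) (g y2) (f z) := by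
        refine ⟨y2, hcol2, ?_⟩
        intro w hw
        simp only [recol]
        split_ifs with h1 h2 h3
        · exact hYW
        · subst h2; exact absurd hw.symm hnadj
        · intro h; exact h1 (hsolo2.2 w hw h)
        · intro h; exact g1 w h3 h2 (h ▸ hWA)
      have hsub : insert (g y2) A ⊆ acc G (recol A f g z y Y (f z)) cm := by
        intro c hc
        rw [mem_acc]
        rcases mem_insert.1 hc with rfl | hc
        · exact ReflTransGen.head hmov2 hWacc
        · by_cases hcW : c = f z
          · rw [hcW]; exact hWacc
          · exact (hacc c ((hTW _ hzT).2.2 c ((hmA _).1 hc) hcW)).2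
      have := card_le_card hsub
      rw [card_insert_of_notMem hg2] at this
      omega

lemma near_equit (G : SimpleGraph V) (s : ℕ) (hdeg : ∀ v, dg G v < Fintype.card C)
    (IH : ∀ q < Fintype.card C, SetHyp G C s q) (cm : C) (n : ℕ) : ∀ (f : V → C) (cp : C),
    Near G s f cm cp → Fintype.card C ≤ (acc G f cm).card + n → ∃ f' : V → C, Equit G s f' := by
  induction n with
  | zero =>
    intro f cp hN hn
    rcases near_step G s hdeg IH f cm cp hN with h | ⟨f', cp', _, h⟩
    · exact h
    · have := card_le_univ (acc G f' cm)
      omega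
  | succ n ih =>
    intro f cp hN hn
    rcases near_step G s hdeg IH f cm cp hN with h | ⟨f', cp', h', h⟩
    · exact h
    · exact ih f' cp' h' (by omega)

/-- the graph keeping only edges inside `T` -/
def restr (G : SimpleGraph V) (T : Finset V) : SimpleGraph V where
  Adj u v := G.Adj u v ∧ u ∈ T ∧ v ∈ T
  symm := ⟨fun _ _ h => ⟨h.1.symm, h.2.2, h.2.1⟩⟩
  loopless := ⟨fun _ h => h.1.ne rfl⟩

lemma restr_dg (G : SimpleGraph V) (T : Finset V) (v : V) : dg (restr G T) v ≤ dg G v := by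
  apply card_le_card
  intro w hw
  simp only [mem_filter, mem_univ, true_and] at hw ⊢
  exact hw.1

lemma all_restr (G : SimpleGraph V) (s : ℕ) (hV : Fintype.card V = Fintype.card C * s)
    (hdeg : ∀ v, dg G v < Fintype.card C)
    (IH : ∀ (G : SimpleGraph V), ∀ q < Fintype.card C, SetHyp G C s q) (T : Finset V) :
    ∃ f : V → C, Equit (restr G T) s f := by
  induction T using Finset.induction_on with
  | empty =>
    have e : V ≃ C × Fin s := Fintype.equivOfCardEq (by simp [hV])
    refine ⟨fun v => (e v).1, ?_, ?_⟩
    · intro u v h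
      exact absurd h.2.1 (by simp)
    · intro c
      have : fib (fun v => (e v).1) c = (univ : Finset (Fin s)).image fun i => e.symm (c, i) := by
        ext v
        simp only [mem_fib, mem_image, mem_univ, true_and]
        constructor
        · intro h
          exact ⟨(e v).2, by rw [← h]; simp⟩
        · rintro ⟨i, rfl⟩
          simp
      rw [this, card_image_of_injective]
      · simp
      · intro i j hij
        simpa using hij
  | insert u T _ ih =>
    obtain ⟨f, hf, hfs⟩ := ih
    have hd' : ∀ v, dg (restr G (insert u T)) v < Fintype.card C :=
      fun v => (restr_dg G _ v).trans_lt (hdeg v)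
    obtain ⟨d, hd⟩ : ∃ d, ∀ w, (restr G (insert u T)).Adj u w → f w ≠ d := by
      by_contra hcon
      push Not at hcon
      have hsub : (univ : Finset C) ⊆
          (univ.filter fun w => (restr G (insert u T)).Adj u w).image f := by
        intro c _
        obtain ⟨w, w1, w2⟩ := hcon c
        rw [mem_image]
        exact ⟨w, by simpa using w1, w2⟩
      have h1 := (card_le_card hsub).trans card_image_le
      have h2 := hd' u
      unfold dg at h2
      rw [card_univ] at h1
      omega
    have hp : Proper (restr G (insert u T)) (Function.update f u d) := by
      intro a b hab
      by_cases ha : a = u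
      · subst ha
        rw [Function.update_self, Function.update_of_ne hab.ne.symm]
        exact (hd b hab).symm
      · by_cases hb : b = u
        · subst hb
          rw [Function.update_self, Function.update_of_ne hab.ne]
          exact hd a hab.symm
        · rw [Function.update_of_ne ha, Function.update_of_ne hb]
          apply hf a b
          refine ⟨hab.1, ?_, ?_⟩
          · exact (mem_insert.1 hab.2.1).resolve_left ha
          · exact (mem_insert.1 hab.2.2).resolve_left hb
    by_cases hdu : f u = d
    · rw [← hdu, Function.update_eq_self] at hp
      exact ⟨f, hp, hfs⟩
    · have h1 := fib_update_new f u d hdu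
      have h2 := fib_update_old f u d hdu
      have h3 := fib_update_other f u d
      refine near_equit (restr G (insert u T)) s hd' (IH _) (f u) (Fintype.card C)
        (Function.update f u d) d ⟨hp, hdu, ?_, ?_, ?_⟩ (by omega)
      · rw [h2, hfs]
      · rw [h1, hfs]
      · intro c c1 c2
        rw [h3 c c1 c2, hfs]

end col

def HS (k : ℕ) : Prop := ∀ (V C : Type) [Fintype V] [Fintype C] (G : SimpleGraph V) (s : ℕ),
  Fintype.card C = k → Fintype.card V = k * s → (∀ v, dg G v < k) →
    ∃ f : V → C, Equit G s f

lemma HS_set (k : ℕ) (h : HS k) (V C : Type) [Fintype V] (G : SimpleGraph V) (s : ℕ) :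
    SetHyp G C s k := by
  intro S D f0 hD hS hdeg
  obtain ⟨f, hf, hfs⟩ := h S D (G.induce (S : Set V)) s (by simpa using hD) (by simpa using hS) (by
    intro v
    refine lt_of_le_of_lt ?_ (hdeg v v.2)
    unfold dg
    rw [← card_map (Function.Embedding.subtype _)]
    apply card_le_card
    intro w hw
    simp only [Finset.mem_map, mem_filter, mem_univ, true_and] at hw ⊢
    obtain ⟨a, ha, rfl⟩ := hw
    exact ⟨ha, a.2⟩)
  refine ⟨fun v => if hv : v ∈ S then (f ⟨v, hv⟩ : C) else f0 v, ?_, ?_, ?_⟩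
  · intro v hv
    simp [hv]
  · intro u hu v hv huv
    simp only [hu, hv, dif_pos]
    intro he
    exact hf ⟨u, hu⟩ ⟨v, hv⟩ huv (Subtype.ext he)
  · intro c hc
    rw [← hfs ⟨c, hc⟩, ← card_map (Function.Embedding.subtype _)]
    congr 1
    ext v
    simp only [Finset.mem_map, mem_filter, mem_univ, true_and, mem_fib]
    constructor
    · rintro ⟨hv, he⟩
      rw [dif_pos hv] at he
      exact ⟨⟨v, hv⟩, Subtype.ext he, rfl⟩
    · rintro ⟨a, ha, rfl⟩
      refine ⟨a.2, ?_⟩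
      simp [ha]

theorem HS_all (k : ℕ) : HS k := by
  induction k using Nat.strong_induction_on with
  | _ k ih =>
    intro V C _ _ G s hC hV hdeg
    subst hC
    obtain ⟨f, hf, hfs⟩ := all_restr (C := C) G s hV hdeg
      (fun G q hq => HS_set q (ih q hq) V C G s) univ
    exact ⟨f, fun u v h => hf u v ⟨h, mem_univ _, mem_univ _⟩, hfs⟩

end HSz

/-- Hajnal–Szemerédi theorem. -/
theorem hajnal_szemeredi (k : ℕ) (hk : 3 ≤ k) (n : ℕ) (hdvd : k ∣ n)
    (G : SimpleGraph (Fin n))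
    (hdeg : ∀ v : Fin n, (1 - 1 / (k : ℝ)) * (n : ℝ) ≤ ((G.neighborSet v).ncard : ℝ)) :
    ∃ 𝒦 : Finset (Finset (Fin n)),
      (∀ S ∈ 𝒦, G.IsNClique k S) ∧
      (∀ S ∈ 𝒦, ∀ T ∈ 𝒦, S ≠ T → Disjoint S T) ∧
      (∀ v : Fin n, ∃ S ∈ 𝒦, v ∈ S) := by
  by_cases hn : n = 0
  · subst hn
    exact ⟨∅, by simp, by simp, fun v => v.elim0⟩
  obtain ⟨m, rfl⟩ := hdvd
  have hk0 : (k : ℝ) ≠ 0 := by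
    have : k ≠ 0 := by omega
    exact_mod_cast this
  have hdeg' : ∀ v, HSz.dg Gᶜ v < m := by
    intro v
    have h1 := hdeg v
    have h2 : (1 - 1 / (k : ℝ)) * ((k * m : ℕ) : ℝ) = k * m - m := by
      push_cast
      field_simp
    rw [h2] at h1
    have h3 : (G.neighborSet v).ncard = (univ.filter fun w => G.Adj v w).card := by
      rw [← Set.ncard_coe_finset]
      congr 1
      ext w
      simp
    rw [h3] at h1
    have h4 : k * m ≤ (univ.filter fun w => G.Adj v w).card + m := by
      have : (k * m : ℝ) ≤ ((univ.filter fun w => G.Adj v w).card : ℝ) + m := by linarith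
      exact_mod_cast this
    have h5 := card_filter_add_card_filter_not (s := (univ : Finset (Fin (k * m))))
      (fun w => G.Adj v w)
    have h6 : (univ.filter fun w => ¬ G.Adj v w).card
        = HSz.dg Gᶜ v + 1 := by
      unfold HSz.dg
      rw [← card_insert_of_notMem (a := v) (by simp)]
      congr 1
      ext w
      simp only [mem_filter, mem_univ, true_and, mem_insert, SimpleGraph.compl_adj]
      constructor
      · intro h
        by_cases hw : w = v
        · exact Or.inl hw
        · exact Or.inr ⟨fun h => hw h.symm, h⟩
      · rintro (rfl | h)
        · exact G.irrefl
        · exact h.2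
    rw [card_univ, Fintype.card_fin] at h5
    omega
  obtain ⟨f, hf, hfs⟩ := HSz.HS_all m (Fin (k * m)) (Fin m) Gᶜ k (by simp)
    (by simp [mul_comm]) hdeg'
  refine ⟨univ.image (HSz.fib f), ?_, ?_, ?_⟩
  · intro S hS
    obtain ⟨c, -, rfl⟩ := mem_image.1 hS
    refine ⟨?_, hfs c⟩
    intro u hu v hv huv
    have hu' := (HSz.mem_fib _ _ _).1 (mem_coe.1 hu)
    have hv' := (HSz.mem_fib _ _ _).1 (mem_coe.1 hv)
    by_contra h
    exact hf u v ((SimpleGraph.compl_adj _ _ _).2 ⟨huv, h⟩) (hu'.trans hv'.symm)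
  · intro S hS T hT hST
    obtain ⟨c, -, rfl⟩ := mem_image.1 hS
    obtain ⟨d, -, rfl⟩ := mem_image.1 hT
    rw [Finset.disjoint_left]
    intro v hv hv'
    apply hST
    rw [← (HSz.mem_fib _ _ _).1 hv, ← (HSz.mem_fib _ _ _).1 hv']
  · intro v
    exact ⟨HSz.fib f (f v), mem_image_of_mem _ (mem_univ _), (HSz.mem_fib _ _ _).2 rfl⟩
end
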